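/- arXiv:2312.13078 — 5 statements merged into one kernel-verified Lean document; each statement's English description precedes it below -/
import Mathlib

section
/- Let f : closed unit ball B̄ⁿ → ℝⁿ be continuous such that f restricted to the boundary sphere ∂Bⁿ is injective, f restricted to the open ball Bⁿ is a local homeomorphism, and the bounded component of ℝⁿ \ f(∂Bⁿ) is simply connected. Then f is a homeomorphism of B̄ⁿ onto its image. -/
open Metric Set Filter Topology MeasureTheory

theorem exists_lipschitzWith_indicator_ball {E F : Type*} [NormedAddCommGroup E]
    [NormedSpace ℝ E] [FiniteDimensional ℝ E] [NormedAddCommGroup F] [NormedSpace ℝ F]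
    {g : E → F} {R : ℝ} (hg : ContDiff ℝ 1 g) (hgR : ∀ x, ‖x‖ = R → g x = 0) :
    ∃ K : NNReal, LipschitzWith K ((ball (0 : E) R).indicator g) ∧
      ∀ x ∈ ball (0 : E) R, ‖fderiv ℝ g x‖ ≤ K := by
  have hc : Continuous (fderiv ℝ g) := hg.continuous_fderiv (by norm_num)
  obtain ⟨C, hC⟩ := (isCompact_closedBall (0 : E) R).exists_bound_of_continuousOn hc.continuousOn
  have hC' : ∀ x ∈ closedBall (0 : E) R, ‖fderiv ℝ g x‖ ≤ (Real.toNNReal C : ℝ) := fun x hx =>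
    (hC x hx).trans (Real.le_coe_toNNReal C)
  refine ⟨Real.toNNReal C, ?_, fun x hx => hC' x (ball_subset_closedBall hx)⟩
  have hlip : LipschitzOnWith (Real.toNNReal C) g (closedBall 0 R) :=
    (convex_closedBall (0 : E) R).lipschitzOnWith_of_nnnorm_fderiv_le
      (fun x _ => (hg.differentiable (by norm_num)) x) hC'
  have key : ∀ x ∈ ball (0 : E) R, ∀ y ∉ ball (0 : E) R,
      dist (g x) 0 ≤ Real.toNNReal C * dist x y := by
    intro x hx y hy
    obtain ⟨z, hz, hzR⟩ : ∃ z ∈ segment ℝ x y, ‖z‖ = R := by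
      have hpre : IsPreconnected (segment ℝ x y) := (convex_segment x y).isPreconnected
      have := hpre.intermediate_value (left_mem_segment ℝ x y) (right_mem_segment ℝ x y)
        (continuous_norm.continuousOn)
      exact this ⟨(mem_ball_zero_iff.1 hx).le, by simpa using hy⟩
    have h1 := hlip.dist_le_mul x (ball_subset_closedBall hx) z (by simp [hzR])
    rw [hgR z hzR] at h1
    refine h1.trans ?_
    gcongr
    rw [← dist_add_dist_of_mem_segment hz]
    exact le_add_of_nonneg_right dist_nonneg
  refine LipschitzWith.of_dist_le_mul fun x y => ?_
  by_cases hx : x ∈ ball (0 : E) R <;> by_cases hy : y ∈ ball (0 : E) R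
  · rw [indicator_of_mem hx, indicator_of_mem hy]
    exact hlip.dist_le_mul x (ball_subset_closedBall hx) y (ball_subset_closedBall hy)
  · rw [indicator_of_mem hx, indicator_of_notMem hy]
    exact key x hx y hy
  · rw [indicator_of_notMem hx, indicator_of_mem hy, dist_comm, dist_comm x]
    exact key y hy x hx
  · rw [indicator_of_notMem hx, indicator_of_notMem hy, dist_self]
    positivity

theorem bijective_id_add {E : Type*} [NormedAddCommGroup E] [NormedSpace ℝ E] [CompleteSpace E]
    {g : E → E} {K : NNReal} (hg : LipschitzWith K g) (hK : K < 1) :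
    Function.Bijective fun x => x + g x := by
  have h : ApproximatesLinearOn (fun x => x + g x)
      ((ContinuousLinearEquiv.refl ℝ E : E ≃L[ℝ] E) : E →L[ℝ] E) univ K := by
    intro x _ y _
    simpa [add_sub_add_comm, ← dist_eq_norm] using hg.dist_le_mul x y
  have hc : Subsingleton E ∨ K < ‖((ContinuousLinearEquiv.refl ℝ E).symm : E →L[ℝ] E)‖₊⁻¹ := by
    cases subsingleton_or_nontrivial E
    · exact Or.inl ‹_›
    · right
      simpa using hK
  exact ⟨injOn_univ.1 (h.injOn hc), h.surjective hc⟩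

theorem exists_sum_det_eq (E : Type*) [NormedAddCommGroup E] [NormedSpace ℝ E]
    [FiniteDimensional ℝ E] {ε : ℝ} (hε : 0 < ε) :
    ∃ (s : Finset ℕ) (t w : ℕ → ℝ), (∀ i, t i ∈ Ioo 0 ε) ∧ ∑ i ∈ s, w i = 1 ∧
      ∀ A : E →L[ℝ] E, (1 + A).det = ∑ i ∈ s, w i * (1 + t i • A).det := by
  classical
  let b := Module.finBasis ℝ E
  let N := Module.finrank ℝ E
  let t : ℕ → ℝ := fun i => ε / (i + 2)
  have ht : Function.Injective t := by
    intro i j h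
    have : (i : ℝ) + 2 = j + 2 := by
      have h1 : (0 : ℝ) < i + 2 := by positivity
      have h2 : (0 : ℝ) < j + 2 := by positivity
      simp only [t] at h
      field_simp at h
      linarith
    exact_mod_cast (add_right_cancel this)
  let s := Finset.range (N + 1)
  let w : ℕ → ℝ := fun i => (Lagrange.basis s t i).eval 1
  have hp : ∀ p : Polynomial ℝ, p.natDegree ≤ N → p.eval 1 = ∑ i ∈ s, w i * p.eval (t i) := by
    intro p hpN
    have := Lagrange.eq_interpolate (s := s) (v := t) (f := p) ht.injOn
      (by
        refine lt_of_le_of_lt Polynomial.degree_le_natDegree ?_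
        simp only [s, Finset.card_range]
        exact_mod_cast Nat.lt_succ_of_le hpN)
    conv_lhs => rw [this]
    rw [Lagrange.interpolate_apply, Polynomial.eval_finsetSum]
    exact Finset.sum_congr rfl fun i _ => by simp [w, mul_comm]
  refine ⟨s, t, w, fun i => ⟨by positivity, ?_⟩, ?_, fun A => ?_⟩
  · have : (1 : ℝ) < i + 2 := by have : (0 : ℝ) ≤ i := by positivity
                                 linarith
    exact div_lt_self hε this
  · simpa using (hp 1 (by simp)).symm
  · let M := LinearMap.toMatrix b b (A : E →ₗ[ℝ] E)
    let p : Polynomial ℝ := Matrix.det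
      ((Polynomial.X : Polynomial ℝ) • M.map Polynomial.C + (1 : Matrix _ _ ℝ).map Polynomial.C)
    have hdet : ∀ c : ℝ, (1 + c • A).det = p.eval c := by
      intro c
      have : p.eval c = Matrix.det (1 + c • M) := by
        rw [← Polynomial.coe_evalRingHom, RingHom.map_det]
        congr 1
        ext i j
        simp [Matrix.one_apply, add_comm, mul_comm c, apply_ite]
      rw [this, ContinuousLinearMap.det, ← LinearMap.det_toMatrix b]
      congr 1
      ext i j
      simp [M, LinearMap.toMatrix_apply, Matrix.one_apply, Finsupp.single_apply, eq_comm]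
    have h1 : p.natDegree ≤ N :=
      (Polynomial.natDegree_det_X_add_C_le M 1).trans (by simp [N])
    have := hp p h1
    simp_rw [hdet, ← this]
    simpa using hdet 1

theorem exists_setIntegral_det_eq {E : Type*} [NormedAddCommGroup E] [NormedSpace ℝ E]
    [FiniteDimensional ℝ E] [MeasurableSpace E] [BorelSpace E] (μ : Measure E)
    [μ.IsAddHaarMeasure] {g : E → E} {R : ℝ} (hg : ContDiff ℝ 1 g)
    (hgR : ∀ x, ‖x‖ = R → g x = 0) :
    ∃ ε > 0, ∀ t ∈ Ioo (0 : ℝ) ε,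
      ∫ x in ball 0 R, (1 + t • fderiv ℝ g x).det ∂μ = μ.real (ball 0 R) := by
  obtain ⟨K, hK, hK'⟩ := exists_lipschitzWith_indicator_ball hg hgR
  have hdet : ∀ᶠ A : E →L[ℝ] E in 𝓝 0, 0 < (1 + A).det := by
    have hc : Continuous fun A : E →L[ℝ] E => (1 + A).det :=
      ContinuousLinearMap.continuous_det.comp (continuous_const.add continuous_id)
    refine hc.continuousAt.eventually (lt_mem_nhds ?_)
    simp [ContinuousLinearMap.det]
  obtain ⟨δ, hδ, hdet⟩ := Metric.eventually_nhds_iff.1 hdet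
  refine ⟨min δ 1 / (K + 1), by positivity, fun t ht => ?_⟩
  have htK : t * K < min δ 1 := by
    have h1 := (lt_div_iff₀ (by positivity : (0 : ℝ) < K + 1)).1 ht.2
    nlinarith [ht.1]
  set h : E → E := fun x => x + t • (ball (0 : E) R).indicator g x with hh
  have hbij : Function.Bijective h := by
    refine bijective_id_add (K := ‖t‖₊ * K) (g := fun x => t • (ball (0 : E) R).indicator g x)
      ((lipschitzWith_smul t).comp hK) ?_
    rw [← NNReal.coe_lt_coe]
    simpa [abs_of_pos ht.1] using htK.trans_le (min_le_right _ _)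
  have hout : ∀ x ∉ ball (0 : E) R, h x = x := fun x hx => by
    simp [hh, indicator_of_notMem hx]
  have himage : h '' ball 0 R = ball 0 R := by
    have h1 : h '' (ball 0 R)ᶜ = (ball 0 R)ᶜ := by
      ext y
      constructor
      · rintro ⟨x, hx, rfl⟩
        rwa [hout x hx]
      · exact fun hy => ⟨y, hy, hout y hy⟩
    rw [← compl_inj_iff, ← image_compl_eq hbij, h1]
  have hderiv : ∀ x ∈ ball (0 : E) R,
      HasFDerivWithinAt h (1 + t • fderiv ℝ g x) (ball 0 R) x := by
    intro x hx
    have h1 : HasFDerivAt (fun x => x + t • g x) (1 + t • fderiv ℝ g x) x :=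
      (hasFDerivAt_id x).add ((hg.differentiable (by norm_num) x).hasFDerivAt.const_smul t)
    refine h1.hasFDerivWithinAt.congr (fun y hy => ?_) ?_
    · simp [hh, indicator_of_mem hy]
    · simp [hh, indicator_of_mem hx]
  have hvol := integral_image_eq_integral_abs_det_fderiv_smul μ measurableSet_ball hderiv
    hbij.1.injOn (fun _ => (1 : ℝ))
  rw [himage] at hvol
  simp only [smul_eq_mul, mul_one, integral_const, measureReal_restrict_apply_univ] at hvol
  rw [hvol]
  refine setIntegral_congr_fun measurableSet_ball fun x hx => ?_
  refine (abs_of_pos (hdet ?_)).symm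
  rw [dist_zero_right, norm_smul, Real.norm_of_nonneg ht.1.le]
  exact (mul_le_mul_of_nonneg_left (hK' x hx) ht.1.le).trans_lt (htK.trans_le (min_le_left _ _))

/-- There is no `C¹` retraction of a ball onto its boundary sphere. -/
theorem not_exists_contDiff_retraction {E : Type*} [NormedAddCommGroup E]
    [InnerProductSpace ℝ E] [FiniteDimensional ℝ E] {r : E → E} {R : ℝ} (hR : 0 < R)
    (hr : ContDiff ℝ 1 r) (hnorm : ∀ x, ‖r x‖ = R) : ∃ x, ‖x‖ = R ∧ r x ≠ x := by
  by_contra! hid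
  borelize E
  let μ : Measure E := Measure.addHaar
  let g : E → E := fun x => r x - x
  have hg : ContDiff ℝ 1 g := hr.sub contDiff_id
  obtain ⟨ε, hε, h_int⟩ := exists_setIntegral_det_eq μ (R := R) hg
    (fun x hx => by simp [g, hid x hx])
  obtain ⟨s, t, w, ht, hw, hsum⟩ := exists_sum_det_eq E hε
  have hcont : ∀ c : ℝ, Continuous fun x => (1 + c • fderiv ℝ g x).det := fun c =>
    ContinuousLinearMap.continuous_det.comp
      (continuous_const.add ((hg.continuous_fderiv (by norm_num)).const_smul c))
  have hone : ∫ x in ball 0 R, (1 + fderiv ℝ g x).det ∂μ = μ.real (ball 0 R) := by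
    rw [show (fun x => (1 + fderiv ℝ g x).det) = _ from funext fun x => hsum (fderiv ℝ g x),
      integral_finsetSum]
    · calc _ = ∑ i ∈ s, w i * μ.real (ball 0 R) :=
            Finset.sum_congr rfl fun i _ => by rw [integral_const_mul, h_int _ (ht i)]
        _ = _ := by rw [← Finset.sum_mul, hw, one_mul]
    · intro i _
      exact ((((hcont (t i)).continuousOn.integrableOn_compact
        (isCompact_closedBall (0 : E) R)).mono_set ball_subset_closedBall).const_mul (w i))
  have hzero : ∀ x, (1 + fderiv ℝ g x).det = 0 := by
    intro x
    have hd := (hr.differentiable (by norm_num) x).hasFDerivAt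
    have h1 : 1 + fderiv ℝ g x = fderiv ℝ r x := by
      have : fderiv ℝ g x = fderiv ℝ r x - 1 := (hd.sub (hasFDerivAt_id x)).fderiv
      rw [this]; abel
    rw [h1]
    by_contra hne
    have hsurj : Function.Surjective (fderiv ℝ r x) := by
      exact (LinearMap.equivOfDetNeZero (fderiv ℝ r x : E →ₗ[ℝ] E) hne).surjective
    obtain ⟨v, hv⟩ := hsurj (r x)
    have h2 := hd.norm_sq
    have h3 : HasFDerivAt (fun x => ‖r x‖ ^ 2) (0 : E →L[ℝ] ℝ) x := by
      simp_rw [hnorm]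
      exact hasFDerivAt_const _ _
    have h4 := DFunLike.congr_fun (h2.unique h3) v
    simp [hv, hnorm, hR.ne'] at h4
  simp only [hzero, integral_zero] at hone
  exact (ENNReal.toReal_pos (measure_ball_pos μ (0 : E) hR).ne' measure_ball_lt_top.ne).ne hone

theorem false_of_continuous_ne_zero {E : Type*} [NormedAddCommGroup E]
    [InnerProductSpace ℝ E] [FiniteDimensional ℝ E] {Φ : E → E} (hΦ : Continuous Φ)
    (hne : ∀ x, Φ x ≠ 0) {R : ℝ} (hR : ∀ x, R ≤ ‖x‖ → Φ x = x) : False := by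
  obtain ⟨Ψ, hΨ, hdist, heq, -⟩ := hΦ.exists_contDiff_approx_and_eqOn 1
    (ε := fun x => ‖Φ x‖) hΦ.norm (fun x => norm_pos_iff.2 (hne x))
    (S := {x | |R| + 1 ≤ ‖x‖}) (U := {x | R < ‖x‖})
    (isClosed_le continuous_const continuous_norm)
    ((isOpen_lt continuous_const continuous_norm).mem_nhdsSet.2 fun x hx => by
      have : |R| + 1 ≤ ‖x‖ := hx
      have := le_abs_self R
      exact (by linarith : R < ‖x‖))
    (contDiff_id.contDiffOn.congr fun x hx => hR x (le_of_lt hx))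
  have hΨne : ∀ x, Ψ x ≠ 0 := fun x hx => by
    have := hdist x
    rw [hx, dist_zero_left] at this
    exact lt_irrefl _ this
  have hpos : 0 < |R| + 1 := by positivity
  obtain ⟨x, hx, hx'⟩ := not_exists_contDiff_retraction hpos
    (r := fun x => (|R| + 1) • ‖Ψ x‖⁻¹ • Ψ x)
    (contDiff_const.smul (((hΨ.norm ℝ hΨne).inv fun x => norm_ne_zero_iff.2 (hΨne x)).smul hΨ))
    (fun x => by
      rw [norm_smul, norm_smul, norm_inv, norm_norm, inv_mul_cancel₀ (norm_ne_zero_iff.2 (hΨne x)),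
        mul_one, Real.norm_of_nonneg hpos.le])
  apply hx'
  have : Ψ x = x := (heq hx.ge).trans (hR x (by have := le_abs_self R; linarith))
  simp only [this, hx]
  rw [smul_smul, mul_inv_cancel₀ hpos.ne', one_smul]

theorem Topology.IsClosedEmbedding.exists_extension_ne_zero {X F E : Type*} [TopologicalSpace X]
    [CompactSpace X] [NormedAddCommGroup F] [NormedSpace ℝ F] [FiniteDimensional ℝ F]
    [NormedAddCommGroup E] [NormedSpace ℝ E] [FiniteDimensional ℝ E]
    (hFE : Module.finrank ℝ F < Module.finrank ℝ E) {e : X → F} (he : IsClosedEmbedding e)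
    (h : C(X, E)) (hh : ∀ x, h x ≠ 0) :
    ∃ H : C(F, E), (∀ y, H y ≠ 0) ∧ ∀ x, H (e x) = h x := by
  have := TietzeExtension.of_tvs ℝ (E := E)
  obtain ⟨G, hG⟩ := h.exists_extension he
  have hGe : ∀ x, G (e x) = h x := fun x => DFunLike.congr_fun hG x
  obtain ⟨δ, hδ, hδh⟩ := isCompact_univ.exists_forall_le' (f := fun x => ‖h x‖) (a := 0)
    h.continuous.norm.continuousOn fun x _ => norm_pos_iff.2 (hh x)
  obtain ⟨G₁, hG₁, hdist, -⟩ := G.continuous.exists_contDiff_approx 1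
    (ε := fun _ => δ / 4) continuous_const fun _ => by positivity
  obtain ⟨v, hv, hvδ⟩ := (hG₁.dense_compl_range_of_finrank_lt_finrank hFE).exists_dist_lt 0
    (by positivity : 0 < δ / 4)
  let φ : F → ℝ := fun y => min 1 (max 0 (2 / δ * ‖G y‖ - 1))
  have hφ : Continuous φ := continuous_const.min (continuous_const.max
    ((continuous_const.mul G.continuous.norm).sub continuous_const))
  have hφ0 : ∀ y, 0 ≤ φ y := fun y => le_min zero_le_one (le_max_left _ _)
  have hφ1 : ∀ y, φ y ≤ 1 := fun y => min_le_left _ _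
  have hclose : ∀ y, ‖(G₁ y - v) - G y‖ < δ / 2 := fun y => by
    have h1 := hdist y
    rw [dist_eq_norm] at h1
    rw [dist_zero_left] at hvδ
    calc ‖(G₁ y - v) - G y‖ = ‖(G₁ y - G y) - v‖ := by congr 1; abel
      _ ≤ _ := norm_sub_le _ _
      _ < _ := by linarith
  refine ⟨⟨fun y => (G₁ y - v) + φ y • (G y - (G₁ y - v)), ?_⟩, fun y => ?_, fun x => ?_⟩
  · exact (hG₁.continuous.sub continuous_const).add
      (hφ.smul (G.continuous.sub (hG₁.continuous.sub continuous_const)))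
  · simp only [ContinuousMap.coe_mk]
    by_cases hy : ‖G y‖ ≤ δ / 2
    · have : φ y = 0 := by
        have h1 : 2 / δ * ‖G y‖ ≤ 1 := by
          rw [div_mul_eq_mul_div, div_le_one hδ]; linarith
        simp only [φ]
        rw [max_eq_left (by linarith), min_eq_right zero_le_one]
      rw [this, zero_smul, add_zero, sub_ne_zero]
      exact fun h => hv ⟨y, h⟩
    · intro h0
      have h1 : G y = -((1 - φ y) • ((G₁ y - v) - G y)) := by
        rw [← sub_eq_zero, ← h0]; module
      apply hy
      rw [h1, norm_neg, norm_smul, Real.norm_of_nonneg (sub_nonneg.2 (hφ1 y))]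
      refine le_trans ?_ (hclose y).le
      exact mul_le_of_le_one_left (norm_nonneg _) (by linarith [hφ0 y])
  · have : φ (e x) = 1 := by
      have h1 : 2 ≤ 2 / δ * ‖G (e x)‖ := by
        rw [hGe, div_mul_eq_mul_div, le_div_iff₀ hδ]
        linarith [hδh x trivial]
      simp only [φ]
      rw [max_eq_right (by linarith), min_eq_left (by linarith)]
    simp [this, hGe]

/-- A compact set with a point off a compact set `c(X)` containing its frontier does not exist
if `X` embeds into a space of smaller dimension. -/
theorem mem_range_of_frontier_subset_range {X F E : Type*} [TopologicalSpace X]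
    [CompactSpace X] [NormedAddCommGroup F] [NormedSpace ℝ F] [FiniteDimensional ℝ F]
    [NormedAddCommGroup E] [InnerProductSpace ℝ E] [FiniteDimensional ℝ E]
    (hFE : Module.finrank ℝ F < Module.finrank ℝ E) {c : X → E} {e : X → F}
    (hc : IsClosedEmbedding c) (he : IsClosedEmbedding e) {W : Set E} (hW : IsCompact W)
    (hfr : frontier W ⊆ range c) {p : E} (hp : p ∈ W) : p ∈ range c := by
  classical
  by_contra hpc
  have := TietzeExtension.of_tvs ℝ (E := F)
  obtain ⟨G, hG⟩ := ContinuousMap.exists_extension hc ⟨e, he.continuous⟩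
  obtain ⟨H, hH0, hH⟩ := he.exists_extension_ne_zero hFE
    ⟨fun x => c x - p, hc.continuous.sub continuous_const⟩
    fun x hx => hpc ⟨x, sub_eq_zero.1 hx⟩
  let Φ : E → E := W.piecewise (fun y => H (G y)) (fun y => y - p)
  have hΦ : Continuous Φ := by
    refine Continuous.piecewise (fun y hy => ?_) (H.continuous.comp G.continuous)
      (continuous_id.sub continuous_const)
    obtain ⟨x, rfl⟩ := hfr hy
    have : G (c x) = e x := DFunLike.congr_fun hG x
    simp [this, hH]
  have hΦ0 : ∀ y, Φ y ≠ 0 := fun y => by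
    by_cases hy : y ∈ W
    · simp [Φ, hy, hH0]
    · simp only [Φ, piecewise_eq_of_notMem _ _ _ hy, ne_eq, sub_eq_zero]
      rintro rfl
      exact hy hp
  obtain ⟨R, hR⟩ := hW.isBounded.subset_ball p
  refine false_of_continuous_ne_zero (Φ := fun z => Φ (z + p)) (R := R)
    (hΦ.comp (continuous_id.add continuous_const)) (fun z => hΦ0 _) fun z hz => ?_
  have : z + p ∉ W := fun h => by
    have := hR h
    rw [mem_ball, dist_eq_norm, add_sub_cancel_right] at this
    linarith
  simp [Φ, this]

theorem IsCoveringMap.injective_of_simplyConnectedSpace {X Y : Type*} [TopologicalSpace X]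
    [TopologicalSpace Y] [PreconnectedSpace X] [SimplyConnectedSpace Y]
    [LocallyPathConnectedSpace Y] {p : X → Y} (hp : IsCoveringMap p) : Function.Injective p := by
  intro x y hxy
  obtain ⟨σ, ⟨hσx, hσ⟩, -⟩ :=
    hp.existsUnique_continuousMap_lifts (ContinuousMap.id Y) (p x) x rfl
  have hid : σ ∘ p = id := hp.eq_of_comp_eq (σ.continuous.comp hp.continuous) continuous_id
    (by rw [← Function.comp_assoc, hσ]; rfl) x hσx
  have hσy : σ (p y) = y := congr_fun hid y
  rw [← hσx, hxy, hσy]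

theorem exists_isClosedEmbedding_orthogonal_of_ne {E : Type*} [NormedAddCommGroup E]
    [InnerProductSpace ℝ E] {T : Set E} (hT : IsCompact T)
    (hTS : T ⊆ sphere 0 1) {v : E} (hv : ‖v‖ = 1) (hvT : v ∉ T) :
    ∃ e : T → (Submodule.span ℝ {v})ᗮ, IsClosedEmbedding e := by
  have := isCompact_iff_compactSpace.1 hT
  refine ⟨fun x => stereoToFun v (x : E), Continuous.isClosedEmbedding ?_ ?_⟩
  · refine continuousOn_stereoToFun.comp_continuous continuous_subtype_val fun x => ?_
    intro h
    have hx : ‖(x : E)‖ = 1 := by simpa using hTS x.2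
    have : v = x := (inner_eq_one_iff_of_norm_eq_one hv hx).1 h
    exact hvT (this ▸ x.2)
  · intro x y hxy
    have hinv : ∀ x : T, (stereoInvFun hv (stereoToFun v (x : E)) : E) = x := fun x =>
      congr_arg Subtype.val (stereo_left_inv hv (x := ⟨x, hTS x.2⟩)
        fun h => hvT ((show (x : E) = v from h) ▸ x.2))
    apply Subtype.ext
    exact (hinv x).symm.trans
      ((congr_arg (fun z => (stereoInvFun hv z : E)) hxy).trans (hinv y))

theorem disjoint_image_ball_image_sphere {E : Type*} [NormedAddCommGroup E]
    [InnerProductSpace ℝ E] [FiniteDimensional ℝ E] {f : E → E}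
    (hcont : ContinuousOn f (closedBall 0 1)) (hinj : InjOn f (sphere 0 1))
    (hopen : IsOpen (f '' ball 0 1)) : Disjoint (f '' ball 0 1) (f '' sphere 0 1) := by
  rw [Set.disjoint_left]
  rintro _ hA ⟨v, hv, rfl⟩
  have hv1 : ‖v‖ = 1 := by simpa using hv
  set T : Set E := sphere 0 1 ∩ f ⁻¹' (f '' ball 0 1)ᶜ with hT
  have hTc : IsCompact T := by
    have : IsClosed T := (hcont.mono sphere_subset_closedBall).preimage_isClosed_of_isClosed
      isClosed_sphere hopen.isClosed_compl
    exact (isCompact_sphere (0 : E) 1).of_isClosed_subset this inter_subset_left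
  obtain ⟨e, he⟩ := exists_isClosedEmbedding_orthogonal_of_ne hTc inter_subset_left hv1
    fun h => h.2 hA
  have := isCompact_iff_compactSpace.1 hTc
  have hc : IsClosedEmbedding fun x : T => f x :=
    Continuous.isClosedEmbedding
      (hcont.comp_continuous continuous_subtype_val fun x => sphere_subset_closedBall x.2.1)
      fun x y hxy => Subtype.ext (hinj x.2.1 y.2.1 hxy)
  have hrank : Module.finrank ℝ (Submodule.span ℝ {v})ᗮ < Module.finrank ℝ E := by
    refine Submodule.finrank_lt ?_
    rw [ne_eq, Submodule.orthogonal_eq_top_iff, Submodule.span_singleton_eq_bot, ← norm_eq_zero, hv1]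
    exact one_ne_zero
  have hW : IsCompact (f '' closedBall 0 1) :=
    (isCompact_closedBall (0 : E) 1).image_of_continuousOn hcont
  have hfr : frontier (f '' closedBall 0 1) ⊆ range fun x : T => f x := by
    rw [hW.isClosed.frontier_eq]
    rintro _ ⟨⟨x, hx, rfl⟩, hxi⟩
    have hxA : f x ∉ f '' ball 0 1 := fun h =>
      hxi (interior_maximal (image_mono ball_subset_closedBall) hopen h)
    have hxS : x ∈ sphere (0 : E) 1 := by
      rw [← ball_union_sphere] at hx
      exact hx.resolve_left fun h => hxA (mem_image_of_mem f h)
    exact ⟨⟨x, hxS, hxA⟩, rfl⟩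
  obtain ⟨x, hx⟩ := mem_range_of_frontier_subset_range hrank hc he hW hfr
    (mem_image_of_mem f (sphere_subset_closedBall hv))
  exact x.2.2 (by simpa only [mem_preimage, hx] using hA)

theorem IsLocalHomeomorphOn.isOpen_image {X Y : Type*} [TopologicalSpace X] [TopologicalSpace Y]
    {f : X → Y} {s : Set X} (hf : IsLocalHomeomorphOn f s) (hs : IsOpen s) : IsOpen (f '' s) := by
  rw [isOpen_iff_mem_nhds]
  rintro _ ⟨x, hx, rfl⟩
  rw [← hf.map_nhds_eq hx]
  exact image_mem_map (hs.mem_nhds hx)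

/-- A local homeomorphism on a set which maps it properly onto a simply connected open set is
injective on it. -/
theorem IsLocalHomeomorphOn.injOn_of_simplyConnectedSpace {X Y : Type*} [TopologicalSpace X]
    [T2Space X] [TopologicalSpace Y] [T2Space Y] [LocallyPathConnectedSpace Y] {f : X → Y}
    {B K : Set X} {C : Set Y}
    (hf : IsLocalHomeomorphOn f B) (hB : IsOpen B) (hBc : IsPreconnected B) (hK : IsCompact K)
    (hBK : B ⊆ K) (hfK : ContinuousOn f K) (hfC : K ∩ f ⁻¹' C = B) (hC : IsOpen C)
    [SimplyConnectedSpace C] : InjOn f B := by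
  have hmaps : MapsTo f B C := fun x hx => (hfC.ge hx).2
  let p : B → C := hmaps.restrict
  have := hC.locallyPathConnectedSpace
  have := isPreconnected_iff_preconnectedSpace.1 hBc
  have hcomp : IsLocalHomeomorph (Subtype.val ∘ p) := by
    rw [isLocalHomeomorph_iff_isLocalHomeomorphOn_univ]
    exact IsLocalHomeomorphOn.comp (g := f) hf
      hB.isOpenEmbedding_subtypeVal.isLocalHomeomorph.isLocalHomeomorphOn fun x _ => x.2
  have hp : IsLocalHomeomorph p := hcomp.of_comp hC.isOpenEmbedding_subtypeVal.isLocalHomeomorph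
    ((hfK.mono hBK).mapsToRestrict hmaps)
  have hpclosed : IsClosedMap p := by
    intro Z hZ
    obtain ⟨Z', hZ', rfl⟩ := isClosed_induced_iff.1 hZ
    have hKZ : IsClosed (f '' (K ∩ Z')) :=
      ((hK.inter_right hZ').image_of_continuousOn (hfK.mono inter_subset_left)).isClosed
    convert hKZ.preimage (continuous_subtype_val (p := (· ∈ C))) using 1
    ext y
    constructor
    · rintro ⟨x, hx, rfl⟩
      exact ⟨x, ⟨hBK x.2, hx⟩, rfl⟩
    · rintro ⟨x, ⟨hxK, hxZ⟩, hxy⟩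
      have hxB : x ∈ B := hfC ▸ ⟨hxK, by simp [hxy]⟩
      exact ⟨⟨x, hxB⟩, hxZ, Subtype.ext hxy⟩
  have hfin : ∀ y ∈ (univ : Set C), (p ⁻¹' {y}).Finite := by
    intro y _
    have hdisc : IsDiscrete (p ⁻¹' {y}) := IsDiscrete.of_openPartialHomeomorph p subset_rfl
      fun e _ => (hp e).imp fun φ hφ => ⟨hφ.1, hφ.2.symm⟩
    refine IsCompact.finite ?_ hdisc
    rw [Subtype.isCompact_iff]
    have h1 : Subtype.val '' (p ⁻¹' {y}) = K ∩ f ⁻¹' {(y : Y)} := by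
      ext x
      constructor
      · rintro ⟨x, hx, rfl⟩
        exact ⟨hBK x.2, congr_arg Subtype.val hx⟩
      · rintro ⟨hxK, hxy⟩
        have hxB : x ∈ B := hfC ▸ ⟨hxK, by rw [mem_preimage, mem_singleton_iff.1 hxy]; exact y.2⟩
        exact ⟨⟨x, hxB⟩, Subtype.ext hxy, rfl⟩
    rw [h1]
    exact hK.of_isClosed_subset
      (hfK.preimage_isClosed_of_isClosed hK.isClosed isClosed_singleton) inter_subset_left
  have hcov : IsCoveringMap p := by
    rw [isCoveringMap_iff_isCoveringMapOn_univ]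
    exact hpclosed.isCoveringMapOn_of_isLocalHomeomorphOn hfin hp.isLocalHomeomorphOn
  exact injOn_iff_injective.2 fun x y hxy =>
    hcov.injective_of_simplyConnectedSpace (Subtype.ext hxy)

/-- A continuous map of the closed unit ball which is injective on the sphere and a local
homeomorphism on the open ball is a homeomorphism onto its image, provided that the bounded
components of the complement of the image of the sphere are simply connected. -/
theorem exists_homeomorph_image_closedBall {E : Type*} [NormedAddCommGroup E]
    [InnerProductSpace ℝ E] [FiniteDimensional ℝ E] {f : E → E}
    (hcont : ContinuousOn f (closedBall 0 1)) (hinj : InjOn f (sphere 0 1))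
    (hloc : IsLocalHomeomorphOn f (ball 0 1))
    (hsc : ∀ x ∉ f '' sphere (0 : E) 1,
      Bornology.IsBounded (connectedComponentIn (f '' sphere (0 : E) 1)ᶜ x) →
      SimplyConnectedSpace (connectedComponentIn (f '' sphere (0 : E) 1)ᶜ x)) :
    ∃ e : closedBall (0 : E) 1 ≃ₜ f '' closedBall (0 : E) 1,
      ∀ x : closedBall (0 : E) 1, (e x : E) = f x := by
  have hopen : IsOpen (f '' ball 0 1) := hloc.isOpen_image isOpen_ball
  have hdisj := disjoint_image_ball_image_sphere hcont hinj hopen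
  have hball : IsPreconnected (ball (0 : E) 1) := (convex_ball 0 1).isPreconnected
  have hW : IsCompact (f '' closedBall (0 : E) 1) :=
    (isCompact_closedBall 0 1).image_of_continuousOn hcont
  have himage : f '' ball 0 1 = f '' closedBall 0 1 ∩ (f '' sphere (0 : E) 1)ᶜ := by
    rw [← ball_union_sphere, image_union, union_inter_distrib_right, inter_compl_self, union_empty,
      inter_eq_left.2 hdisj.subset_compl_right]
  have h0 : f 0 ∈ f '' ball (0 : E) 1 := mem_image_of_mem f (mem_ball_self one_pos)
  have hcomp : connectedComponentIn (f '' sphere (0 : E) 1)ᶜ (f 0) = f '' ball 0 1 := by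
    refine Subset.antisymm ?_ ((hball.image f (hcont.mono ball_subset_closedBall)
      ).subset_connectedComponentIn h0 hdisj.subset_compl_right)
    have hsub := connectedComponentIn_subset (f '' sphere (0 : E) 1)ᶜ (f 0)
    have hpre : IsPreconnected (connectedComponentIn (f '' sphere (0 : E) 1)ᶜ (f 0)) :=
      isPreconnected_connectedComponentIn
    refine hpre.subset_left_of_subset_union hopen hW.isClosed.isOpen_compl ?_ ?_ ?_
    · exact disjoint_compl_right.mono_left (image_mono ball_subset_closedBall)
    · intro y hy
      by_cases hyW : y ∈ f '' closedBall (0 : E) 1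
      · exact Or.inl (himage ▸ ⟨hyW, hsub hy⟩)
      · exact Or.inr hyW
    · exact ⟨f 0, mem_connectedComponentIn (hdisj.subset_compl_right h0), h0⟩
  have hSC := hsc (f 0) (hdisj.subset_compl_right h0)
    (by rw [hcomp]; exact hW.isBounded.subset (image_mono ball_subset_closedBall))
  rw [hcomp] at hSC
  have hinjB : InjOn f (ball 0 1) := by
    refine hloc.injOn_of_simplyConnectedSpace isOpen_ball hball (isCompact_closedBall 0 1)
      ball_subset_closedBall hcont (C := f '' ball 0 1) ?_ hopen
    ext x
    constructor
    · rintro ⟨hx, hx'⟩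
      rw [← ball_union_sphere] at hx
      exact hx.resolve_right fun h => Set.disjoint_left.1 hdisj hx' (mem_image_of_mem f h)
    · exact fun hx => ⟨ball_subset_closedBall hx, mem_image_of_mem f hx⟩
  have hinjW : InjOn f (closedBall 0 1) := by
    rw [← ball_union_sphere, injOn_union (disjoint_left.2 fun x hx hx' => by
      simp only [mem_ball_zero_iff, mem_sphere_zero_iff_norm] at hx hx'; linarith)]
    exact ⟨hinjB, hinj, fun x hx y hy hxy =>
      Set.disjoint_left.1 hdisj (mem_image_of_mem f hx) (hxy ▸ mem_image_of_mem f hy)⟩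
  have := isCompact_iff_compactSpace.1 (isCompact_closedBall (0 : E) 1)
  exact ⟨Continuous.homeoOfEquivCompactToT2 (f := Equiv.Set.imageOfInjOn f _ hinjW)
    ((hcont.domRestrict).subtype_mk _), fun x => rfl⟩

/-- A continuous map of the closed unit ball which is injective on the boundary sphere,
a local homeomorphism on the open ball, and whose image of the sphere has a simply connected
bounded complementary component, is a homeomorphism onto its image. -/
theorem stmt3 {n : ℕ}
    (f : EuclideanSpace ℝ (Fin (n + 2)) → EuclideanSpace ℝ (Fin (n + 2)))
    (hcont : ContinuousOn f (closedBall 0 1))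
    (hinj : Set.InjOn f (sphere 0 1))
    (hloc : IsLocalHomeomorphOn f (ball 0 1))
    (hsc : ∀ x ∉ f '' sphere (0 : EuclideanSpace ℝ (Fin (n + 2))) 1,
      Bornology.IsBounded
        (connectedComponentIn (f '' sphere (0 : EuclideanSpace ℝ (Fin (n + 2))) 1)ᶜ x) →
      SimplyConnectedSpace
        (connectedComponentIn (f '' sphere (0 : EuclideanSpace ℝ (Fin (n + 2))) 1)ᶜ x)) :
    ∃ e : (closedBall (0 : EuclideanSpace ℝ (Fin (n + 2))) 1) ≃ₜ
        (f '' closedBall (0 : EuclideanSpace ℝ (Fin (n + 2))) 1),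
      ∀ x : closedBall (0 : EuclideanSpace ℝ (Fin (n + 2))) 1,
        (e x : EuclideanSpace ℝ (Fin (n + 2))) = f x :=
  exists_homeomorph_image_closedBall hcont hinj hloc hsc
end

section
/- Let Ω ⊂ ℝⁿ be a bounded domain and F, G : Ω → ℝⁿ homeomorphisms onto their respective images. If F = G on a neighborhood of ∂Ω (i.e., on Ω minus some compactly contained subdomain), then F(Ω) = G(Ω). -/
open MeasureTheory Metric Set Topology

/-- `det (1 + t A)` is a polynomial in `t` of degree at most the dimension. -/
theorem exists_polynomial_eval_eq_det_one_add_smul {E : Type*} [NormedAddCommGroup E]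
    [NormedSpace ℝ E] [FiniteDimensional ℝ E] (A : E →L[ℝ] E) :
    ∃ p : Polynomial ℝ, p.natDegree ≤ Module.finrank ℝ E ∧
      ∀ t : ℝ, p.eval t = (1 + t • A : E →L[ℝ] E).det := by
  let b := Module.finBasis ℝ E
  let M := LinearMap.toMatrix b b (A : E →ₗ[ℝ] E)
  let N : Matrix (Fin (Module.finrank ℝ E)) (Fin (Module.finrank ℝ E)) ℝ := 1
  refine ⟨((Polynomial.X : Polynomial ℝ) • M.map Polynomial.C + N.map Polynomial.C).det,
    ?_, fun t => ?_⟩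
  · simpa using Polynomial.natDegree_det_X_add_C_le M N
  · rw [← Polynomial.coe_evalRingHom, RingHom.map_det, ContinuousLinearMap.det,
      ← LinearMap.det_toMatrix b]
    congr 1
    have : ((1 + t • A : E →L[ℝ] E) : E →ₗ[ℝ] E) = LinearMap.id + t • (A : E →ₗ[ℝ] E) := rfl
    rw [this, map_add (LinearMap.toMatrix b b), map_smul (LinearMap.toMatrix b b),
      LinearMap.toMatrix_id]
    ext i j
    simp [M, N, Matrix.one_apply, apply_ite, add_comm]
    ring

/-- If the integral of `det (1 + t A)` is constant for small `t > 0`, it has the same value at `t = 1`. -/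
theorem setIntegral_det_one_add_eq_of_forall_small {E : Type*} [NormedAddCommGroup E]
    [NormedSpace ℝ E] [FiniteDimensional ℝ E] [MeasurableSpace E] [BorelSpace E]
    {μ : Measure E} [IsFiniteMeasureOnCompacts μ] {K : Set E} (hK : IsCompact K)
    {A : E → E →L[ℝ] E} (hA : Continuous A) {c t₀ : ℝ} (ht₀ : 0 < t₀)
    (h : ∀ t ∈ Ioc 0 t₀, ∫ x in K, (1 + t • A x).det ∂μ = c) :
    ∫ x in K, (1 + A x).det ∂μ = c := by
  classical
  set s := Finset.range (Module.finrank ℝ E + 1)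
  let v : ℕ → ℝ := fun i => t₀ / (i + 1)
  have hv : InjOn v s := fun i _ j _ hij => by
    have : (i : ℝ) + 1 = j + 1 := by
      have h1 : (0 : ℝ) < i + 1 := by positivity
      have h2 : (0 : ℝ) < j + 1 := by positivity
      have h3 : t₀ / ((i : ℝ) + 1) = t₀ / (j + 1) := hij
      field_simp at h3
      linarith
    exact_mod_cast add_right_cancel this
  have hvm : ∀ i, v i ∈ Ioc 0 t₀ := fun i =>
    ⟨by positivity, div_le_self ht₀.le (by norm_cast; omega)⟩
  have key : ∀ p : Polynomial ℝ, p.natDegree ≤ Module.finrank ℝ E →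
      p.eval 1 = ∑ i ∈ s, (Lagrange.basis s v i).eval 1 * p.eval (v i) := by
    intro p hp
    have hdeg : p.degree < s.card := by
      refine p.degree_le_natDegree.trans_lt ?_
      simp only [s, Finset.card_range]
      exact_mod_cast Nat.lt_succ_of_le hp
    conv_lhs => rw [Lagrange.eq_interpolate hv hdeg, Lagrange.interpolate_apply]
    simp [Polynomial.eval_finsetSum, mul_comm]
  have hpt : ∀ x, (1 + A x).det =
      ∑ i ∈ s, (Lagrange.basis s v i).eval 1 * (1 + v i • A x).det := by
    intro x
    obtain ⟨p, hp, hpe⟩ := exists_polynomial_eval_eq_det_one_add_smul (A x)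
    have := key p hp
    simpa [hpe] using this
  have hint : ∀ i ∈ s, Integrable
      (fun x => (Lagrange.basis s v i).eval 1 * (1 + v i • A x).det) (μ.restrict K) := by
    intro i _
    refine Integrable.const_mul ?_ _
    have hc : Continuous fun x => (1 + v i • A x).det :=
      ContinuousLinearMap.continuous_det.comp (by fun_prop)
    exact hc.continuousOn.integrableOn_compact hK
  have hone := key 1 (by simp)
  simp only [Polynomial.eval_one, mul_one] at hone
  simp_rw [hpt]
  rw [integral_finsetSum _ hint]
  simp_rw [integral_const_mul]
  rw [Finset.sum_congr rfl fun i _ => by rw [h _ (hvm i)], ← Finset.sum_mul, ← hone, one_mul]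

/-- A map which is Lipschitz on the closed unit ball and vanishes on the sphere can be extended
by zero to a Lipschitz map. -/
theorem lipschitzWith_indicator_closedBall {E F : Type*} [NormedAddCommGroup E]
    [NormedSpace ℝ E] [NormedAddCommGroup F] {g : E → F} {L : NNReal}
    (hg : LipschitzOnWith L g (closedBall 0 1)) (h0 : ∀ x, ‖x‖ = 1 → g x = 0) :
    LipschitzWith L ((closedBall 0 1).indicator g) := by
  have mixed : ∀ x y : E, ‖x‖ ≤ 1 → 1 < ‖y‖ → dist (g x) 0 ≤ L * dist x y := by
    intro x y hx hy
    obtain ⟨z, hz, hz1⟩ : ∃ z ∈ segment ℝ x y, ‖z‖ = 1 :=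
      (convex_segment x y).isPreconnected.intermediate_value (left_mem_segment ℝ x y)
        (right_mem_segment ℝ x y) continuous_norm.continuousOn ⟨hx, hy.le⟩
    rw [← h0 z hz1]
    refine (hg.dist_le_mul x (by simpa using hx) z (by simp [hz1])).trans ?_
    gcongr
    linarith [dist_add_dist_of_mem_segment hz, dist_nonneg (x := z) (y := y)]
  refine LipschitzWith.of_dist_le_mul fun x y => ?_
  rcases le_or_gt ‖x‖ 1 with hx | hx <;> rcases le_or_gt ‖y‖ 1 with hy | hy
  · simpa [indicator, hx, hy] using hg.dist_le_mul x (by simpa using hx) y (by simpa using hy)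
  · simpa [indicator, hx, hy.not_ge] using mixed x y hx hy
  · simpa [indicator, hx.not_ge, hy, dist_comm] using mixed y x hy hx
  · simp only [indicator, mem_closedBall, dist_zero_right, hx.not_ge, hy.not_ge, if_false,
      dist_self]
    positivity

/-- A small Lipschitz perturbation of the identity, fixing the unit sphere, is a bijection of the
closed unit ball. -/
theorem bijOn_closedBall_add_smul {E : Type*} [NormedAddCommGroup E] [NormedSpace ℝ E]
    [CompleteSpace E] {g : E → E} {L : NNReal} (hg : LipschitzOnWith L g (closedBall 0 1))
    (h0 : ∀ x, ‖x‖ = 1 → g x = 0) {t : ℝ} (ht : 0 ≤ t) (htL : t * L < 1)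
    (hmaps : MapsTo (fun x => x + t • g x) (closedBall 0 1) (closedBall 0 1)) :
    BijOn (fun x => x + t • g x) (closedBall 0 1) (closedBall 0 1) := by
  refine ⟨hmaps, fun x hx y hy hxy => ?_, fun y hy => ?_⟩
  · have h1 : x - y = t • (g y - g x) := by
      simp only at hxy
      rw [smul_sub, sub_eq_sub_iff_add_eq_add, hxy, add_comm]
    have h2 : ‖x - y‖ ≤ t * (L * ‖x - y‖) := by
      conv_lhs => rw [h1, norm_smul, Real.norm_of_nonneg ht]
      gcongr
      rw [norm_sub_rev x y]
      simpa [dist_eq_norm] using hg.dist_le_mul y hy x hx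
    have h3 : ‖x - y‖ = 0 := by nlinarith [norm_nonneg (x - y)]
    exact sub_eq_zero.1 (norm_eq_zero.1 h3)
  · have hlip := lipschitzWith_indicator_closedBall hg h0
    set G := (closedBall (0 : E) 1).indicator g with hG
    have hc : ContractingWith (t.toNNReal * L) fun x => y - t • G x := by
      refine ⟨by rw [← NNReal.coe_lt_coe]; simpa [Real.coe_toNNReal t ht] using htL, LipschitzWith.of_dist_le_mul ?_⟩
      intro a b
      rw [dist_sub_left, dist_smul₀, Real.norm_of_nonneg ht]
      have := hlip.dist_le_mul a b
      simp only [NNReal.coe_mul, Real.coe_toNNReal t ht, mul_assoc]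
      gcongr
    have hfix : y - t • G _ = _ := hc.fixedPoint_isFixedPt
    set x := hc.fixedPoint
    by_cases hx : x ∈ closedBall (0 : E) 1
    · refine ⟨x, hx, ?_⟩
      rw [hG, indicator_of_mem hx] at hfix
      exact (sub_eq_iff_eq_add.1 hfix).symm
    · rw [hG, indicator_of_notMem hx, smul_zero, sub_zero] at hfix
      exact absurd (hfix ▸ hy) hx

/-- There is no `C¹` retraction of the closed unit ball onto the unit sphere. -/
theorem not_exists_contDiff_retraction_sphere {E : Type*} [NormedAddCommGroup E]
    [InnerProductSpace ℝ E] [FiniteDimensional ℝ E] {H : E → E} (hH : ContDiff ℝ 1 H)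
    (hnorm : ∀ x, ‖H x‖ = 1) (hid : ∀ x, ‖x‖ = 1 → H x = x) : False := by
  let : MeasurableSpace E := borel E
  have : BorelSpace E := ⟨rfl⟩
  let b := stdOrthonormalBasis ℝ E
  let μ : Measure E := b.toBasis.addHaar
  set B := closedBall (0 : E) 1
  have hBc : IsCompact B := isCompact_closedBall 0 1
  set g : E → E := fun x => H x - x
  have hg : ContDiff ℝ 1 g := hH.sub contDiff_id
  have hg0 : ∀ x, ‖x‖ = 1 → g x = 0 := fun x hx => by simp [g, hid x hx]
  have hA : Continuous (fderiv ℝ g) := hg.continuous_fderiv one_ne_zero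
  have hgd : Differentiable ℝ g := hg.differentiable one_ne_zero
  obtain ⟨L, hLpos, hL⟩ : ∃ L : NNReal, 0 < L ∧ ∀ x ∈ B, ‖fderiv ℝ g x‖ ≤ L := by
    obtain ⟨C, hC⟩ := hBc.exists_bound_of_continuousOn hA.continuousOn
    refine ⟨⟨max C 1, by positivity⟩, ?_, fun x hx => (hC x hx).trans (le_max_left _ _)⟩
    exact NNReal.coe_pos.1 (lt_max_of_lt_right one_pos)
  have hlip : LipschitzOnWith L g B := (convex_closedBall 0 1).lipschitzOnWith_of_nnnorm_fderiv_le
    (fun x _ => hgd x) (fun x hx => hL x hx)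
  obtain ⟨η, hη, hdet⟩ : ∃ η > 0, ∀ T : E →L[ℝ] E, dist T 1 < η → 0 < T.det := by
    have : ∀ᶠ T in 𝓝 (1 : E →L[ℝ] E), 0 < T.det :=
      ContinuousLinearMap.continuous_det.continuousAt.eventually
        (lt_mem_nhds (by simp [ContinuousLinearMap.det]))
    exact Metric.eventually_nhds_iff.1 this
  have hL' : (0 : ℝ) < L := hLpos
  set t₀ := min (min η 1 / (2 * L)) 1
  have ht₀ : 0 < t₀ := by positivity
  have hvol : ∀ t ∈ Ioc 0 t₀, ∫ x in B, (1 + t • fderiv ℝ g x).det ∂μ = μ.real B := by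
    intro t ht
    have ht1 : t ≤ 1 := ht.2.trans (min_le_right _ _)
    have htL : t * L ≤ min η 1 / 2 := by
      have h1 : t ≤ min η 1 / (2 * L) := ht.2.trans (min_le_left _ _)
      calc t * L ≤ min η 1 / (2 * L) * L := by gcongr
        _ = min η 1 / 2 := by field_simp
    have hbij : BijOn (fun x => x + t • g x) B B := by
      refine bijOn_closedBall_add_smul hlip hg0 ht.1.le
        (by linarith [min_le_right η 1]) fun x hx => ?_
      have h1 : x + t • g x = (1 - t) • x + t • H x := by simp only [g]; module
      simp only [h1]
      exact convex_closedBall (0 : E) 1 hx (by simp [hnorm]) (by linarith) ht.1.le (by ring)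
    have hpos : ∀ x ∈ B, 0 < (1 + t • fderiv ℝ g x).det := by
      intro x hx
      refine hdet _ ?_
      rw [dist_eq_norm, add_sub_cancel_left, norm_smul, Real.norm_of_nonneg ht.1.le]
      have : t * ‖fderiv ℝ g x‖ ≤ t * L := by gcongr; exacts [ht.1.le, hL x hx]
      linarith [min_le_left η 1]
    have hcv := lintegral_abs_det_fderiv_eq_addHaar_image μ (s := B)
      (f := fun x => x + t • g x) (f' := fun x => 1 + t • fderiv ℝ g x)
      measurableSet_closedBall
      (fun x _ => ((hasFDerivAt_id x).add
        ((hgd x).hasFDerivAt.const_smul t)).hasFDerivWithinAt) hbij.injOn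
    rw [hbij.image_eq] at hcv
    rw [integral_eq_lintegral_of_nonneg_ae
      ((ae_restrict_mem measurableSet_closedBall).mono fun x hx => (hpos x hx).le)
      (ContinuousLinearMap.continuous_det.comp
        (continuous_const.add (hA.const_smul t))).aestronglyMeasurable, measureReal_def, ← hcv]
    congr 1
    exact setLIntegral_congr_fun measurableSet_closedBall fun x hx => by
      simp only [abs_of_pos (hpos x hx)]
  have hone := setIntegral_det_one_add_eq_of_forall_small hBc hA ht₀ hvol
  have hzero : ∀ x, (1 + fderiv ℝ g x).det = 0 := by
    intro x
    have hHd : HasFDerivAt H (fderiv ℝ H x) x := (hH.differentiable one_ne_zero x).hasFDerivAt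
    have h1 : 1 + fderiv ℝ g x = fderiv ℝ H x := by
      have : HasFDerivAt g (fderiv ℝ H x - 1) x := hHd.sub (hasFDerivAt_id x)
      rw [this.fderiv, add_sub_cancel]
    rw [h1]
    by_contra hne
    obtain ⟨w, hw⟩ : ∃ w, fderiv ℝ H x w = H x := by
      have := (LinearMap.equivOfDetNeZero (fderiv ℝ H x : E →ₗ[ℝ] E) hne).surjective (H x)
      exact this
    have h2 := (hHd.inner ℝ hHd)
    have h3 : (fun y => inner ℝ (H y) (H y)) = fun _ => (1 : ℝ) := by
      ext y; simp [hnorm]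
    rw [h3] at h2
    have h4 := congrArg (fun T => T w) (h2.unique (hasFDerivAt_const (1 : ℝ) x))
    simp [hw, hnorm] at h4
  simp only [hzero, integral_zero] at hone
  have : 0 < μ.real B := ENNReal.toReal_pos
    ((measure_closedBall_pos μ 0 one_pos).ne') hBc.measure_lt_top.ne
  linarith

/-- A continuous map on the closed unit ball that stays close to the identity has a zero. -/
theorem exists_eq_zero_of_norm_sub_le {E : Type*} [NormedAddCommGroup E]
    [InnerProductSpace ℝ E] [FiniteDimensional ℝ E] {u : E → E}
    (hu : ContinuousOn u (closedBall 0 1)) (hclose : ∀ x, ‖x‖ ≤ 1 → ‖u x - x‖ ≤ 1 / 2) :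
    ∃ x, ‖x‖ ≤ 1 ∧ u x = 0 := by
  by_contra! hne
  have : TietzeExtension E := TietzeExtension.of_tvs ℝ
  obtain ⟨U, hU⟩ := ContinuousMap.exists_restrict_eq isClosed_closedBall
    ⟨_, continuousOn_iff_continuous_domRestrict.1 hu⟩
  have hUu : ∀ x, ‖x‖ ≤ 1 → U x = u x := fun x hx =>
    congrArg (fun f => f ⟨x, by simpa using hx⟩) hU
  obtain ⟨δ, hδ, hδu⟩ : ∃ δ > 0, ∀ x, ‖x‖ ≤ 1 → δ ≤ ‖u x‖ := by
    obtain ⟨x₀, hx₀, hmin⟩ := (isCompact_closedBall (0 : E) 1).exists_isMinOn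
      ⟨0, by simp⟩ hu.norm
    exact ⟨‖u x₀‖, norm_pos_iff.2 (hne x₀ (by simpa using hx₀)),
      fun x hx => hmin (by simpa using hx)⟩
  obtain ⟨p, hp, hpU, -⟩ := U.continuous.exists_contDiff_approx 1
    (ε := fun _ => min δ (1 / 4)) continuous_const (fun _ => by positivity)
  simp only [lt_min_iff, dist_eq_norm] at hpU
  let χ : ContDiffBump (0 : E) := ⟨3 / 4, 1, by norm_num, by norm_num⟩
  let h : E → E := fun x => x + χ x • (p x - x)
  have hh : ContDiff ℝ 1 h := contDiff_id.add (χ.contDiff.smul (hp.sub contDiff_id))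
  have hout : ∀ x, 1 ≤ ‖x‖ → h x = x := fun x hx => by
    simp [h, χ.zero_of_le_dist (x := x) (by simpa [χ] using hx)]
  have hpx : ∀ x, ‖x‖ ≤ 1 → ‖p x - x‖ < 3 / 4 := fun x hx => by
    have h1 := (hpU x).2
    rw [hUu x hx] at h1
    linarith [norm_sub_le_norm_sub_add_norm_sub (p x) (u x) x, hclose x hx]
  have hne0 : ∀ x, h x ≠ 0 := by
    intro x hx
    rcases le_or_gt 1 ‖x‖ with h1 | h1
    · rw [hout x h1] at hx
      norm_num [hx] at h1
    rcases le_or_gt ‖x‖ (3 / 4) with h2 | h2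
    · have h3 : p x = 0 := by
        simpa [h, χ.one_of_mem_closedBall (x := x) (by simpa [χ] using h2)] using hx
      have h4 := (hpU x).1
      rw [h3, hUu x h1.le, zero_sub, norm_neg] at h4
      exact (hδu x h1.le).not_gt h4
    · have h3 : ‖x‖ = ‖χ x • (p x - x)‖ := by
        simpa using congrArg norm (eq_neg_of_add_eq_zero_left hx)
      rw [norm_smul, Real.norm_of_nonneg χ.nonneg] at h3
      have := mul_le_of_le_one_left (norm_nonneg (p x - x)) (χ.le_one (x := x))
      linarith [hpx x h1.le]
  refine not_exists_contDiff_retraction_sphere (H := fun x => ‖h x‖⁻¹ • h x)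
    (((hh.norm ℝ hne0).inv fun x => norm_ne_zero_iff.2 (hne0 x)).smul hh)
    (fun x => ?_) (fun x hx => ?_)
  · rw [norm_smul, norm_inv, norm_norm, inv_mul_cancel₀ (norm_ne_zero_iff.2 (hne0 x))]
  · simp [hout x hx.ge, hx]

/-- An injective continuous map on the closed unit ball sends the centre to an interior point of
the image. -/
theorem image_closedBall_mem_nhds {E : Type*} [NormedAddCommGroup E]
    [InnerProductSpace ℝ E] [FiniteDimensional ℝ E] {f : E → E}
    (hf : ContinuousOn f (closedBall 0 1)) (hinj : InjOn f (closedBall 0 1)) :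
    f '' closedBall 0 1 ∈ 𝓝 (f 0) := by
  let : MeasurableSpace E := borel E
  have : BorelSpace E := ⟨rfl⟩
  let μ : Measure E := (stdOrthonormalBasis ℝ E).toBasis.addHaar
  have : TietzeExtension E := TietzeExtension.of_tvs ℝ
  by_contra hnot
  have hBc : IsCompact (closedBall (0 : E) 1) := isCompact_closedBall 0 1
  have hK : IsCompact (f '' closedBall 0 1) := hBc.image_of_continuousOn hf
  obtain ⟨G, hG⟩ : ∃ G : C(E, E), ∀ x, ‖x‖ ≤ 1 → G (f x) = x := by
    have : CompactSpace (closedBall (0 : E) 1) := isCompact_iff_compactSpace.1 hBc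
    have he : Topology.IsClosedEmbedding ((closedBall (0 : E) 1).domRestrict f) :=
      (continuousOn_iff_continuous_domRestrict.1 hf).isClosedEmbedding (injOn_iff_injective.1 hinj)
    obtain ⟨G, hG⟩ := ContinuousMap.exists_extension he
      (⟨Subtype.val, continuous_subtype_val⟩ : C(closedBall (0 : E) 1, E))
    exact ⟨G, fun x hx => congrArg (fun g => g ⟨x, by simpa using hx⟩) hG⟩
  have hG0 : G (f 0) = 0 := hG 0 (by simp)
  obtain ⟨r, hr, hGr⟩ := Metric.continuousAt_iff.1 (G.continuous.continuousAt (x := f 0)) (1 / 10)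
    (by norm_num)
  simp only [hG0, dist_zero_right] at hGr
  set ε := r / 3
  have hε : 0 < ε := by positivity
  obtain ⟨c, hc, hcK⟩ : ∃ c, ‖f 0 - c‖ < ε ∧ c ∉ f '' closedBall 0 1 := by
    by_contra! hall
    exact hnot (Metric.mem_nhds_iff.2 ⟨ε, hε, fun c hc => hall c (by
      rwa [← dist_eq_norm, dist_comm])⟩)
  obtain ⟨δ, hδ, hδG⟩ : ∃ δ > 0, ∀ y ∈ f '' closedBall 0 1, ε ≤ ‖y - c‖ → δ ≤ ‖G y‖ := by
    set S := f '' closedBall 0 1 ∩ {y | ε ≤ ‖y - c‖} with hS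
    have hSc : IsCompact S := hK.inter_right (isClosed_le continuous_const (by fun_prop))
    rcases S.eq_empty_or_nonempty with hSe | hSne
    · refine ⟨1, one_pos, fun y hy hyc => ?_⟩
      have : y ∈ S := ⟨hy, hyc⟩
      simp [hSe] at this
    · obtain ⟨y₀, ⟨⟨x, hx, rfl⟩, hyc⟩, hmin⟩ :=
        hSc.exists_isMinOn hSne G.continuous.norm.continuousOn
      refine ⟨‖G (f x)‖, norm_pos_iff.2 fun h0 => ?_, fun y hy hyc' => hmin ⟨hy, hyc'⟩⟩
      rw [hG x (by simpa using hx)] at h0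
      rw [h0] at hyc
      exact hc.not_ge hyc
  set η := min (δ / 2) (1 / 10)
  have hη : 0 < η := by positivity
  have hηδ : η ≤ δ / 2 := min_le_left _ _
  have hη10 : η ≤ 1 / 10 := min_le_right _ _
  obtain ⟨P, hP, hPG, -⟩ := G.continuous.exists_contDiff_approx 1
    (ε := fun _ => η) continuous_const (fun _ => hη)
  simp only [dist_eq_norm] at hPG
  obtain ⟨a, ha, haP⟩ : ∃ a, ‖a‖ < η ∧ a ∉ P '' sphere c ε := by
    by_contra! hall
    have h0 : μ (P '' sphere c ε) = 0 :=
      addHaar_image_eq_zero_of_differentiableOn_of_addHaar_eq_zero μ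
        (hP.differentiable one_ne_zero).differentiableOn
        (Measure.addHaar_sphere_of_ne_zero μ c hε.ne')
    have h1 : μ (ball 0 η) = 0 := measure_mono_null (fun a ha => hall a (by simpa using ha)) h0
    exact (measure_ball_pos μ (0 : E) hη).ne' h1
  have hQG : ∀ y, ‖P y - a - G y‖ < 2 * η := fun y => by
    have h1 : P y - a - G y = (P y - G y) - a := by abel
    rw [h1]
    linarith [norm_sub_le (P y - G y) a, hPG y]
  let Φ : E → E := fun y => c + max (ε / ‖y - c‖) 1 • (y - c)
  have hΦfar : ∀ y, ε ≤ ‖y - c‖ → Φ y = y := fun y hy => by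
    simp [Φ, max_eq_right (div_le_one_of_le₀ hy (norm_nonneg _))]
  have hΦnear : ∀ y, y ≠ c → ‖y - c‖ ≤ ε → Φ y ∈ sphere c ε := fun y hyc hy => by
    have h1 : 0 < ‖y - c‖ := norm_pos_iff.2 (sub_ne_zero.2 hyc)
    rw [mem_sphere_iff_norm]
    simp only [Φ]
    rw [add_sub_cancel_left, max_eq_left ((one_le_div h1).2 hy), norm_smul, norm_div, norm_norm,
      Real.norm_of_nonneg hε.le, div_mul_cancel₀ _ h1.ne']
  have hfc : ∀ x, ‖x‖ ≤ 1 → f x ≠ c := fun x hx hxc => hcK ⟨x, by simpa using hx, hxc⟩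
  have hcont : ContinuousOn (fun x => P (Φ (f x)) - a) (closedBall 0 1) := by
    refine ContinuousOn.sub (hP.continuous.comp_continuousOn ?_) continuousOn_const
    refine continuousOn_const.add (ContinuousOn.smul (ContinuousOn.sup (continuousOn_const.div
      (hf.sub continuousOn_const).norm fun x hx => ?_) continuousOn_const)
      (hf.sub continuousOn_const))
    exact norm_ne_zero_iff.2 (sub_ne_zero.2 (hfc x (by simpa using hx)))
  obtain ⟨x, hx, hx0⟩ := exists_eq_zero_of_norm_sub_le hcont fun x hx => by
    rcases le_or_gt ε ‖f x - c‖ with h1 | h1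
    · rw [hΦfar _ h1]
      have := hQG (f x)
      rw [hG x hx] at this
      linarith
    · have h2 := mem_sphere_iff_norm.1 (hΦnear _ (hfc x hx) h1.le)
      have h3 : ‖G (Φ (f x))‖ < 1 / 10 := hGr (by
        rw [dist_eq_norm]
        linarith [norm_sub_le_norm_sub_add_norm_sub (Φ (f x)) c (f 0), norm_sub_rev c (f 0),
          show r = 3 * ε by simp only [ε]; ring])
      have h4 : ‖x‖ < 1 / 10 := by
        rw [← hG x hx]
        exact hGr (by
          rw [dist_eq_norm]
          linarith [norm_sub_le_norm_sub_add_norm_sub (f x) c (f 0), norm_sub_rev c (f 0),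
            show r = 3 * ε by simp only [ε]; ring])
      have h5 : P (Φ (f x)) - a - x = (P (Φ (f x)) - a - G (Φ (f x))) + G (Φ (f x)) - x := by
        abel
      rw [h5]
      linarith [norm_sub_le ((P (Φ (f x)) - a - G (Φ (f x))) + G (Φ (f x))) x,
        norm_add_le (P (Φ (f x)) - a - G (Φ (f x))) (G (Φ (f x))), hQG (Φ (f x))]
  rcases le_or_gt ε ‖f x - c‖ with h1 | h1
  · have h2 := hQG (f x)
    rw [hΦfar _ h1] at hx0
    rw [hx0, zero_sub, norm_neg] at h2
    linarith [hδG (f x) ⟨x, by simpa using hx, rfl⟩ h1]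
  · exact haP ⟨_, hΦnear _ (hfc x hx) h1.le, sub_eq_zero.1 hx0⟩

/-- **Invariance of domain**: an injective continuous map on an open set has open image. -/
theorem isOpen_image_of_continuousOn_of_injOn {E : Type*} [NormedAddCommGroup E]
    [InnerProductSpace ℝ E] [FiniteDimensional ℝ E] {f : E → E}
    {s : Set E} (hs : IsOpen s) (hf : ContinuousOn f s) (hinj : InjOn f s) :
    IsOpen (f '' s) := by
  rw [isOpen_iff_mem_nhds]
  rintro _ ⟨a, ha, rfl⟩
  obtain ⟨r, hr, hrs⟩ := Metric.nhds_basis_closedBall.mem_iff.1 (hs.mem_nhds ha)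
  have hmaps : MapsTo (fun x => a + r • x) (closedBall 0 1) s := fun x hx => hrs (by
    have : ‖x‖ ≤ 1 := by simpa using hx
    simpa [norm_smul, abs_of_pos hr] using mul_le_of_le_one_right hr.le this)
  have key := image_closedBall_mem_nhds (f := fun x => f (a + r • x))
    (hf.comp (by fun_prop) hmaps) fun x hx y hy hxy => by
      simpa [hr.ne'] using hinj (hmaps hx) (hmaps hy) hxy
  simp only [smul_zero, add_zero] at key
  refine Filter.mem_of_superset key ?_
  rintro _ ⟨x, hx, rfl⟩
  exact ⟨_, hmaps hx, rfl⟩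

/-- If `F` and `G` agree on `s` off a relatively compact subset `t`, and the images under `F` of
open subsets of `s` are open, then `F` maps `s` into `G '' s`. -/
theorem image_subset_image_of_eqOn_diff {E : Type*} [TopologicalSpace E] [T2Space E]
    [PreconnectedSpace E] [NoncompactSpace E] {F G : E → E} {s t : Set E}
    (hF : ContinuousOn F s) (hG : ContinuousOn G s) (hFi : InjOn F s)
    (hFo : ∀ u ⊆ s, IsOpen u → IsOpen (F '' u)) (hGo : IsOpen (G '' s)) (ht : IsOpen t)
    (hts : closure t ⊆ s) (htc : IsCompact (closure t)) (hFG : ∀ x ∈ s \ t, F x = G x) :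
    F '' s ⊆ G '' s := by
  have hsub : t ⊆ s := subset_closure.trans hts
  set A := F '' closure t \ G '' s with hA
  have hAc : IsCompact A := (htc.image_of_continuousOn (hF.mono hts)).diff hGo
  have hAeq : A = F '' t \ G '' closure t := by
    ext y
    constructor
    · rintro ⟨⟨x, hx, rfl⟩, hy⟩
      refine ⟨⟨x, ?_, rfl⟩, fun h => hy (image_mono hts h)⟩
      by_contra hxt
      exact hy ⟨x, hts hx, (hFG x ⟨hts hx, hxt⟩).symm⟩
    · rintro ⟨⟨x, hx, rfl⟩, hy⟩
      refine ⟨⟨x, subset_closure hx, rfl⟩, ?_⟩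
      rintro ⟨z, hz, hzx⟩
      by_cases hzt : z ∈ t
      · exact hy ⟨z, subset_closure hzt, hzx⟩
      · rw [← hFG z ⟨hz, hzt⟩] at hzx
        exact hzt (hFi hz (hsub hx) hzx ▸ hx)
  have hAo : IsOpen A := by
    rw [hAeq]
    exact (hFo t hsub ht).sdiff (htc.image_of_continuousOn (hG.mono hts)).isClosed
  have hAe : A = ∅ := (isClopen_iff.1 ⟨hAc.isClosed, hAo⟩).resolve_right hAc.ne_univ
  rintro _ ⟨x, hx, rfl⟩
  by_cases hxt : x ∈ t
  · by_contra hn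
    have : F x ∈ A := ⟨⟨x, subset_closure hxt, rfl⟩, hn⟩
    simp [hAe] at this
  · exact ⟨x, hx, (hFG x ⟨hx, hxt⟩).symm⟩


/-- If two homeomorphisms onto their images of a bounded domain `Ω ⊂ ℝⁿ` agree near the
boundary of `Ω`, then they have the same image. -/
theorem stmt4 {n : ℕ} (Ω : Set (EuclideanSpace ℝ (Fin n)))
    (hΩo : IsOpen Ω) (hΩc : IsConnected Ω) (hΩb : Bornology.IsBounded Ω)
    (F G : EuclideanSpace ℝ (Fin n) → EuclideanSpace ℝ (Fin n))
    (hF : Topology.IsEmbedding (Ω.restrict F))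
    (hG : Topology.IsEmbedding (Ω.restrict G))
    (Ω₁ : Set (EuclideanSpace ℝ (Fin n)))
    (hΩ₁o : IsOpen Ω₁) (hΩ₁c : IsConnected Ω₁)
    (hΩ₁sub : closure Ω₁ ⊆ Ω) (hΩ₁cpt : IsCompact (closure Ω₁))
    (hFG : ∀ x ∈ Ω \ Ω₁, F x = G x) :
    F '' Ω = G '' Ω := by
  rcases n with _ | n
  · obtain ⟨x, hx⟩ := hΩc.nonempty
    exact (Subsingleton.eq_univ_of_nonempty ((nonempty_of_mem hx).image F)).trans
      (Subsingleton.eq_univ_of_nonempty ((nonempty_of_mem hx).image G)).symm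
  have hFc : ContinuousOn F Ω := continuousOn_iff_continuous_domRestrict.2 hF.continuous
  have hGc : ContinuousOn G Ω := continuousOn_iff_continuous_domRestrict.2 hG.continuous
  have hFi : InjOn F Ω := injOn_iff_injective.2 hF.injective
  have hGi : InjOn G Ω := injOn_iff_injective.2 hG.injective
  have hopen : ∀ f : EuclideanSpace ℝ (Fin (n + 1)) → EuclideanSpace ℝ (Fin (n + 1)),
      ContinuousOn f Ω → InjOn f Ω → ∀ u ⊆ Ω, IsOpen u → IsOpen (f '' u) :=
    fun f hf hfi u hu huo => isOpen_image_of_continuousOn_of_injOn huo (hf.mono hu) (hfi.mono hu)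
  exact (image_subset_image_of_eqOn_diff hFc hGc hFi (hopen F hFc hFi)
      (hopen G hGc hGi Ω subset_rfl hΩo) hΩ₁o hΩ₁sub hΩ₁cpt hFG).antisymm
    (image_subset_image_of_eqOn_diff hGc hFc hGi (hopen G hGc hGi)
      (hopen F hFc hFi Ω subset_rfl hΩo) hΩ₁o hΩ₁sub hΩ₁cpt fun x hx => (hFG x hx).symm)
end

section
/- Let A ∈ GL(n)⁺ and r > 0. Then there exists ϱ ∈ (0, r) and a C^∞ diffeomorphism H : ℝⁿ → ℝⁿ such that H(x) = Ax for x ∈ B(0, ϱ) and H(x) = x for x ∈ ℝⁿ \ B(0, r). -/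
open Filter Topology

/-- A smooth perturbation of the identity by a map with Lipschitz constant less than `1` is a
diffeomorphism. -/
theorem LipschitzWith.exists_contDiff_equiv_id_add {E : Type*} [NormedAddCommGroup E]
    [NormedSpace ℝ E] [CompleteSpace E] {g : E → E} {c : NNReal} (hg : LipschitzWith c g)
    (hc : c < 1) (hsmooth : ContDiff ℝ (⊤ : ℕ∞) g) :
    ∃ H : E ≃ E, (∀ x, H x = x + g x) ∧ ContDiff ℝ (⊤ : ℕ∞) ⇑H ∧
      ContDiff ℝ (⊤ : ℕ∞) ⇑H.symm := by
  have happrox : ApproximatesLinearOn (fun x => x + g x)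
      ((ContinuousLinearEquiv.refl ℝ E : E ≃L[ℝ] E) : E →L[ℝ] E) Set.univ c := by
    intro x _ y _
    have hsub : x + g x - (y + g y) - (x - y) = g x - g y := by abel
    change ‖x + g x - (y + g y) - (x - y)‖ ≤ c * ‖x - y‖
    rw [hsub]
    exact hg.norm_sub_le x y
  have hc' : Subsingleton E ∨
      c < ‖((ContinuousLinearEquiv.refl ℝ E).symm : E →L[ℝ] E)‖₊⁻¹ := by
    rcases subsingleton_or_nontrivial E with h | h
    · exact Or.inl h
    · right
      have hnorm : ‖((ContinuousLinearEquiv.refl ℝ E).symm : E →L[ℝ] E)‖₊ = 1 :=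
        NNReal.eq ContinuousLinearMap.norm_id
      rwa [hnorm, inv_one]
  have hunit (x : E) : IsUnit (1 + fderiv ℝ g x) := by
    have h : ‖-fderiv ℝ g x‖ < 1 := by
      rw [norm_neg]
      exact (norm_fderiv_le_of_lipschitz ℝ hg).trans_lt (by exact_mod_cast hc)
    simpa using isUnit_one_sub_of_norm_lt_one h
  have hsum : ContDiff ℝ (⊤ : ℕ∞) (fun x => x + g x) := contDiff_id.add hsmooth
  refine ⟨(happrox.toHomeomorph _ hc').toEquiv, fun x => rfl, hsum,
    (happrox.toHomeomorph _ hc').contDiff_symm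
      (f₀' := fun x => ContinuousLinearEquiv.unitsEquiv ℝ E (hunit x).unit) (fun x => ?_) hsum⟩
  have hderiv : HasFDerivAt g (fderiv ℝ g x) x :=
    (hsmooth.differentiable (by simp) x).hasFDerivAt
  exact (hasFDerivAt_id x).add hderiv

/-- Some smooth diffeomorphism of `E` agrees with `L` near `0`
and with the identity outside the ball of radius `r`. -/
def ExtendsByIdentity {E : Type*} [NormedAddCommGroup E] [NormedSpace ℝ E] (r : ℝ)
    (L : E →L[ℝ] E) : Prop :=
  ∃ ϱ ∈ Set.Ioo (0 : ℝ) r, ∃ H : E ≃ E,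
    ContDiff ℝ (⊤ : ℕ∞) ⇑H ∧ ContDiff ℝ (⊤ : ℕ∞) ⇑H.symm ∧
      (∀ x ∈ Metric.ball (0 : E) ϱ, H x = L x) ∧ (∀ x ∉ Metric.ball (0 : E) r, H x = x)

namespace ExtendsByIdentity

variable {E : Type*} [NormedAddCommGroup E] [NormedSpace ℝ E] {r : ℝ}

theorem mul {L M : E →L[ℝ] E} (hL : ExtendsByIdentity r L) (hM : ExtendsByIdentity r M) :
    ExtendsByIdentity r (L * M) := by
  obtain ⟨a, ha, F, hF, hF', hFL, hFid⟩ := hL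
  obtain ⟨b, hb, G, hG, hG', hGM, hGid⟩ := hM
  have hnhds : M ⁻¹' Metric.ball 0 a ∩ Metric.ball 0 b ∈ 𝓝 (0 : E) :=
    inter_mem (M.continuous.continuousAt.preimage_mem_nhds
      (by simpa using Metric.ball_mem_nhds (0 : E) ha.1)) (Metric.ball_mem_nhds _ hb.1)
  obtain ⟨c, hc, hcsub⟩ := Metric.mem_nhds_iff.1 hnhds
  refine ⟨min c b, ⟨lt_min hc hb.1, (min_le_right _ _).trans_lt hb.2⟩, G.trans F,
    hF.comp hG, hG'.comp hF', fun x hx => ?_, fun x hx => ?_⟩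
  · have h := hcsub (Metric.ball_subset_ball (min_le_left _ _) hx)
    simp only [Equiv.trans_apply, hGM x h.2, mul_apply_eq_comp]
    exact hFL _ h.1
  · simp only [Equiv.trans_apply, hGid x hx, hFid x hx]

theorem eventually_nhds_one [FiniteDimensional ℝ E] (hr : 0 < r) :
    ∀ᶠ L in 𝓝 (1 : E →L[ℝ] E), ExtendsByIdentity r L := by
  have : CompleteSpace E := FiniteDimensional.complete ℝ E
  let φ : ContDiffBump (0 : E) := ⟨r / 2, r, by positivity, by linarith⟩
  have hφ : ContDiff ℝ (⊤ : ℕ∞) (fun x : E => φ x • x) := φ.contDiff.smul contDiff_id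
  obtain ⟨K, hK⟩ := hφ.lipschitzWith_of_hasCompactSupport
    (φ.hasCompactSupport.smul_right (f' := fun x : E => x)) (by simp)
  have hsmall : ∀ᶠ L in 𝓝 (1 : E →L[ℝ] E), ‖L - 1‖₊ * K < 1 := by
    have hcont : Continuous fun L : E →L[ℝ] E => ‖L - 1‖₊ * K := by fun_prop
    exact hcont.continuousAt.eventually_lt_const (by simp)
  filter_upwards [hsmall] with L hL
  obtain ⟨H, hH, hsmooth, hsymm⟩ := LipschitzWith.exists_contDiff_equiv_id_add
    ((L - 1).lipschitz.comp hK) hL ((L - 1).contDiff.comp hφ)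
  refine ⟨r / 2, ⟨by positivity, by linarith⟩, H, hsmooth, hsymm, fun x hx => ?_, fun x hx => ?_⟩
  · have h1 : φ x = 1 := φ.one_of_mem_closedBall (Metric.ball_subset_closedBall hx)
    simp [hH, h1]
  · have h0 : φ x = 0 := φ.zero_of_le_dist (by simpa using hx)
    simp [hH, h0]

end ExtendsByIdentity

/-- A property that is stable under multiplication and holds near `1` holds on one-parameter
subgroups. -/
theorem of_eventually_nhds_one_of_map_add {M : Type*} [Monoid M] [TopologicalSpace M]
    {P : M → Prop} (hmul : ∀ a b, P a → P b → P (a * b)) (hone : ∀ᶠ a in 𝓝 1, P a) {γ : ℝ → M}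
    (hγ : Continuous γ) (hzero : γ 0 = 1) (hadd : ∀ s t, γ (s + t) = γ s * γ t) (t : ℝ) :
    P (γ t) := by
  have hlim : Tendsto (fun N : ℕ => γ (t / N)) atTop (𝓝 1) :=
    hzero ▸ (hγ.tendsto 0).comp (tendsto_const_div_atTop_nhds_zero_nat t)
  obtain ⟨N, hN, hpos⟩ := ((hlim.eventually hone).and (eventually_gt_atTop 0)).exists
  have hmultiple (k : ℕ) : P (γ (k * (t / N))) := by
    induction k with
    | zero => simpa [hzero] using hone.self_of_nhds
    | succ k ih =>
      push_cast
      rw [add_mul, one_mul, hadd]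
      exact hmul _ _ ih hN
  have h := hmultiple N
  rwa [mul_div_cancel₀] at h
  exact Nat.cast_ne_zero.2 (Nat.pos_iff_ne_zero.1 hpos)

namespace Matrix

variable {ι : Type*} [Fintype ι] [DecidableEq ι]

/-- The matrix `diag(c, c⁻¹)` in two distinct coordinates is a product of transvections. -/
theorem SpecialLinearGroup.diag2n_eq_transvection_mul {F : Type*} [Field F] {i j : ι}
    (hij : i ≠ j) {c : F} (hc : c ≠ 0) :
    diag2n hij c hc = transvection hij c * (transvection hij.symm (-c⁻¹) * (transvection hij c *
      (transvection hij (-1) * (transvection hij.symm 1 * (transvection hij (-1) * 1))))) := by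
  apply Subtype.ext
  ext a b
  change diagonal _ a b = (Matrix.transvection i j c * (Matrix.transvection j i (-c⁻¹) *
    (Matrix.transvection i j c * (Matrix.transvection i j (-1) * (Matrix.transvection j i 1 *
      (Matrix.transvection i j (-1) * 1))))) : Matrix ι ι F) a b
  by_cases ha : a = i
  · subst ha
    simp [hij, hij.symm, diagonal_apply, one_apply, -mul_one, -Matrix.mul_one]
    grind
  · by_cases ha' : a = j
    · subst ha'
      simp [hij, hij.symm, diagonal_apply, one_apply, -mul_one, -Matrix.mul_one]
      grind
    · simp [ha, ha', diagonal_apply, one_apply, -mul_one, -Matrix.mul_one]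

/-- A multiplicative property of real matrices that holds near `1` holds for all matrices of
positive determinant. -/
theorem of_eventually_nhds_one_of_det_pos {P : Matrix ι ι ℝ → Prop}
    (hmul : ∀ A B, P A → P B → P (A * B)) (hone : ∀ᶠ A in 𝓝 1, P A) (A : Matrix ι ι ℝ)
    (hA : 0 < A.det) : P A := by
  rcases isEmpty_or_nonempty ι with hι | ⟨⟨i₀⟩⟩
  · rw [Subsingleton.elim A 1]
    exact hone.self_of_nhds
  let γ : ℝ → Matrix ι ι ℝ := fun t => diagonal (Function.update 1 i₀ (Real.exp t))
  have hγdet (t : ℝ) : (γ t).det = Real.exp t := by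
    simp [γ, Finset.prod_update_of_mem]
  have hγzero : γ 0 = 1 := by simp [γ]
  have hγadd (s t : ℝ) : γ (s + t) = γ s * γ t := by
    simp only [γ, diagonal_mul_diagonal, Real.exp_add]
    congr 1
    ext k
    by_cases hk : k = i₀
    · subst hk; simp
    · simp [hk]
  have hγcont : Continuous γ :=
    Continuous.matrix_diagonal (continuous_const.update i₀ Real.continuous_exp)
  have hγ (t : ℝ) : P (γ t) := of_eventually_nhds_one_of_map_add hmul hone hγcont hγzero hγadd t
  have htransvec (i j : ι) (hij : i ≠ j) (c : ℝ) : P (transvection i j c) := by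
    refine of_eventually_nhds_one_of_map_add hmul hone (γ := transvection i j) ?_
      (transvection_zero i j) (fun s t => (transvection_mul_transvection_same i j hij s t).symm) c
    unfold transvection
    refine continuous_const.add (continuous_matrix fun a b => ?_)
    simp only [single_apply]
    split_ifs <;> fun_prop
  have hSL (S : SpecialLinearGroup ι ℝ) : P S := by
    rcases subsingleton_or_nontrivial ι with hι | hι
    · have hS : (S : Matrix ι ι ℝ) = 1 := by
        ext a b
        rw [Subsingleton.elim b a, one_apply_eq]
        exact (det_eq_elem_of_subsingleton (S : Matrix ι ι ℝ) a).symm.trans S.det_coe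
      rw [hS]
      exact hone.self_of_nhds
    · have hmulSL (S T : SpecialLinearGroup ι ℝ) (hS : P S) (hT : P T) :
          P (S * T : SpecialLinearGroup ι ℝ) := hmul _ _ hS hT
      refine SpecialLinearGroup.diagonal_transvection_induction' (fun S => P S) S
        (fun i j hij c hc => ?_) htransvec hmulSL
      have hji := htransvec j i hij.symm
      have hij' := htransvec i j hij
      rw [SpecialLinearGroup.diag2n_eq_transvection_mul]
      exact hmulSL _ _ (hij' _) <| hmulSL _ _ (hji _) <| hmulSL _ _ (hij' _) <|
        hmulSL _ _ (hij' _) <| hmulSL _ _ (hji _) <| hmulSL _ _ (hij' _) hone.self_of_nhds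
  have hdet : (γ (-Real.log A.det) * A).det = 1 := by
    rw [det_mul, hγdet, Real.exp_neg, Real.exp_log hA, inv_mul_cancel₀ hA.ne']
  have hfactor : A = γ (Real.log A.det) * (γ (-Real.log A.det) * A) := by
    rw [← mul_assoc, ← hγadd, add_neg_cancel, hγzero, one_mul]
  rw [hfactor]
  exact hmul _ _ (hγ _) (hSL ⟨_, hdet⟩)

end Matrix

/-- For any matrix `A` of positive determinant and any `r > 0` there is `ϱ ∈ (0, r)` and a
`C^∞` diffeomorphism of `ℝⁿ` equal to `x ↦ Ax` on `B(0, ϱ)` and to the identity outside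
`B(0, r)`. -/
theorem stmt7 {n : ℕ} (A : Matrix (Fin n) (Fin n) ℝ) (hA : 0 < A.det)
    (r : ℝ) (hr : 0 < r) :
    ∃ ϱ ∈ Set.Ioo (0 : ℝ) r,
      ∃ H : EuclideanSpace ℝ (Fin n) ≃ EuclideanSpace ℝ (Fin n),
        ContDiff ℝ (⊤ : ℕ∞) ⇑H ∧ ContDiff ℝ (⊤ : ℕ∞) ⇑H.symm ∧
        (∀ x ∈ Metric.ball (0 : EuclideanSpace ℝ (Fin n)) ϱ,
          H x = Matrix.toEuclideanLin A x) ∧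
        (∀ x ∉ Metric.ball (0 : EuclideanSpace ℝ (Fin n)) r, H x = x) := by
  have hcont : Continuous (Matrix.toEuclideanCLM (n := Fin n) (𝕜 := ℝ)) :=
    (Matrix.toEuclideanCLM (n := Fin n) (𝕜 := ℝ)).toAlgEquiv.toLinearMap
      |>.continuous_of_finiteDimensional
  exact Matrix.of_eventually_nhds_one_of_det_pos
    (P := fun B => ExtendsByIdentity r (Matrix.toEuclideanCLM (n := Fin n) (𝕜 := ℝ) B))
    (fun B C hB hC => by simpa only [map_mul] using hB.mul hC)
    (hcont.continuousAt.eventually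
      (by simpa only [map_one] using ExtendsByIdentity.eventually_nhds_one hr)) A hA
end

section
/- Fix r > 0 and θ ∈ (0,1), and let A₁, A₂ ∈ GL(n)⁺ with A₁(B(0, θr)) compactly contained in A₂(B(0, r)). Then there exists a C^∞ diffeomorphism H : ℝⁿ → ℝⁿ that coincides with x ↦ A₁x on B(0, θr) and with x ↦ A₂x on ℝⁿ \ B(0, r). -/
open Set Filter Topology

namespace Matrix

variable {m : Type*} [DecidableEq m]

lemma flip_eq_diagonal {i j : m} (hij : i ≠ j) :
    (1 - (2 : ℝ) • (single i i 1 + single j j 1) : Matrix m m ℝ) =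
      diagonal fun k ↦ if k = i ∨ k = j then -1 else 1 := by
  ext a b
  simp only [sub_apply, smul_apply, add_apply, single_apply, diagonal_apply, one_apply, smul_eq_mul]
  grind

variable [Fintype m]

/-- The real matrices with positive determinant. -/
def posDet (m : Type*) [Fintype m] [DecidableEq m] : Set (Matrix m m ℝ) := {M | 0 < M.det}

lemma joinedIn_posDet_mul {M N : Matrix m m ℝ} (hM : JoinedIn (posDet m) 1 M)
    (hN : JoinedIn (posDet m) 1 N) : JoinedIn (posDet m) 1 (M * N) := by
  have h := hM.mul hN
  rw [one_mul] at h
  refine h.mono ?_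
  rintro _ ⟨A, hA, B, hB, rfl⟩
  simpa only [posDet, mem_ofPred_eq, det_mul] using mul_pos hA hB

lemma joinedIn_posDet_transvection {i j : m} (hij : i ≠ j) (c : ℝ) :
    JoinedIn (posDet m) 1 (transvection i j c) := by
  refine JoinedIn.of_segment_subset ?_
  rintro _ ⟨a, b, -, -, hab, rfl⟩
  have h : a • (1 : Matrix m m ℝ) + b • transvection i j c = transvection i j (b * c) := by
    rw [transvection, transvection, smul_add, ← add_assoc, ← add_smul, hab, one_smul, smul_single,
      smul_eq_mul]
  simp [h, posDet, det_transvection_of_ne i j hij]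

lemma joinedIn_posDet_diagonal_of_pos {d : m → ℝ} (hd : ∀ i, 0 < d i) :
    JoinedIn (posDet m) 1 (diagonal d) := by
  refine JoinedIn.of_segment_subset ?_
  rintro _ ⟨a, b, ha, hb, hab, rfl⟩
  have h : a • (1 : Matrix m m ℝ) + b • diagonal d = diagonal fun i ↦ a + b * d i := by
    rw [← diagonal_one, ← diagonal_smul, ← diagonal_smul, diagonal_add]
    simp
  rw [h, posDet, mem_ofPred_eq, det_diagonal]
  refine Finset.prod_pos fun i _ ↦ ?_
  rcases hb.eq_or_lt with rfl | hb
  · linarith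
  · nlinarith [mul_pos hb (hd i)]

/-- Minus the identity on a coordinate plane is the square of a product of three transvections. -/
lemma sq_transvection_prod_eq {i j : m} (hij : i ≠ j) :
    (transvection i j (1 : ℝ) * transvection j i (-1) * transvection i j 1) *
      (transvection i j 1 * transvection j i (-1) * transvection i j 1) =
      1 - (2 : ℝ) • (single i i 1 + single j j 1) := by
  have h : transvection i j (1 : ℝ) * transvection j i (-1) * transvection i j 1 =
      1 - (single i i 1 + single j j 1) + (single i j 1 - single j i 1) := by
    have h' : (single j i (-1) : Matrix m m ℝ) = - single j i 1 := by
      ext; simp [single_apply]; split_ifs <;> simp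
    simp only [transvection, h', mul_add, add_mul, mul_one, one_mul, mul_neg, neg_mul,
      single_mul_single_same, single_mul_single_of_ne _ _ _ _ hij.symm]
    abel
  rw [h, two_smul]
  simp [mul_add, add_mul, mul_sub, sub_mul, hij, hij.symm]
  abel

lemma joinedIn_posDet_flip {i j : m} (hij : i ≠ j) :
    JoinedIn (posDet m) 1 (1 - (2 : ℝ) • (single i i 1 + single j j 1)) := by
  rw [← sq_transvection_prod_eq hij]
  have h := joinedIn_posDet_mul (joinedIn_posDet_mul (joinedIn_posDet_transvection hij 1)
    (joinedIn_posDet_transvection hij.symm (-1))) (joinedIn_posDet_transvection hij 1)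
  exact joinedIn_posDet_mul h h

lemma joinedIn_posDet_diagonal {d : m → ℝ} (hd : 0 < ∏ i, d i) :
    JoinedIn (posDet m) 1 (diagonal d) := by
  induction hN : (Finset.univ.filter fun i ↦ d i < 0).card using Nat.strong_induction_on
    generalizing d with
  | _ N ih =>
  have hne : ∀ i, d i ≠ 0 := fun i hi ↦
    hd.ne' (Finset.prod_eq_zero (Finset.mem_univ i) hi)
  by_cases hpos : ∀ i, 0 < d i
  · exact joinedIn_posDet_diagonal_of_pos hpos
  push Not at hpos
  obtain ⟨i, hi⟩ := hpos
  replace hi := hi.lt_of_ne (hne i)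
  obtain ⟨j, hij, hj⟩ : ∃ j, i ≠ j ∧ d j < 0 := by
    by_contra! h
    rw [← Finset.mul_prod_erase _ _ (Finset.mem_univ i)] at hd
    have : 0 ≤ ∏ k ∈ Finset.univ.erase i, d k :=
      Finset.prod_nonneg fun k hk ↦ h k (Finset.ne_of_mem_erase hk).symm
    nlinarith
  set s : m → ℝ := fun k ↦ if k = i ∨ k = j then -1 else 1 with hs
  have hs_sq : ∀ k, s k * s k = 1 := fun k ↦ by simp only [hs]; split_ifs <;> norm_num
  have hs_pos : 0 < ∏ k, s k := by
    have := (joinedIn_posDet_flip hij).target_mem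
    rwa [flip_eq_diagonal hij, posDet, mem_ofPred_eq, det_diagonal] at this
  have key : diagonal d =
      (1 - (2 : ℝ) • (single i i 1 + single j j 1)) * diagonal fun k ↦ s k * d k := by
    rw [flip_eq_diagonal hij, diagonal_mul_diagonal]
    congr 1
    ext k
    rw [← mul_assoc, hs_sq, one_mul]
  rw [key]
  refine joinedIn_posDet_mul (joinedIn_posDet_flip hij) (ih _ ?_ ?_ rfl)
  · rw [← hN]
    refine Finset.card_lt_card (Finset.ssubset_iff_of_subset ?_ |>.2 ⟨i, ?_, ?_⟩)
    · intro k
      simp only [Finset.mem_filter, Finset.mem_univ, true_and, hs]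
      split_ifs with hk
      · rcases hk with rfl | rfl <;> intro _ <;> assumption
      · simp
    · simpa using hi
    · simpa [hs] using hi.le
  · rw [Finset.prod_mul_distrib]
    exact mul_pos hs_pos hd

/-- The group of real matrices with positive determinant is path connected. -/
theorem joinedIn_posDet {M : Matrix m m ℝ} (hM : 0 < M.det) : JoinedIn (posDet m) 1 M := by
  refine diagonal_transvection_induction (fun N ↦ JoinedIn (posDet m) 1 N) M
    (fun D hD ↦ joinedIn_posDet_diagonal ?_)
    (fun t ↦ joinedIn_posDet_transvection t.hij t.c) fun _ _ ↦ joinedIn_posDet_mul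
  rwa [← det_diagonal, hD]

end Matrix

section Diffeo

variable {E : Type*} [NormedAddCommGroup E] [InnerProductSpace ℝ E] {ρ r : ℝ}

/-- Two maps are related when they agree on `B(0, ρ)` up to postcomposition with a diffeomorphism
that is the identity outside `B(0, r)`. -/
def SupportedDiffeoRel (ρ r : ℝ) (C C' : E →L[ℝ] E) : Prop :=
  ∃ K : E ≃ E, ContDiff ℝ (⊤ : ℕ∞) K ∧ ContDiff ℝ (⊤ : ℕ∞) K.symm ∧
    (∀ x ∈ Metric.ball (0 : E) ρ, K (C x) = C' x) ∧ ∀ x ∉ Metric.ball (0 : E) r, K x = x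

lemma SupportedDiffeoRel.symm {C C' : E →L[ℝ] E} (h : SupportedDiffeoRel ρ r C C') :
    SupportedDiffeoRel ρ r C' C := by
  obtain ⟨K, h1, h2, h3, h4⟩ := h
  refine ⟨K.symm, h2, h1, fun x hx ↦ ?_, fun x hx ↦ ?_⟩
  · rw [← h3 x hx, K.symm_apply_apply]
  · rw [K.symm_apply_eq, h4 x hx]

lemma SupportedDiffeoRel.trans {C C' C'' : E →L[ℝ] E} (h : SupportedDiffeoRel ρ r C C')
    (h' : SupportedDiffeoRel ρ r C' C'') : SupportedDiffeoRel ρ r C C'' := by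
  obtain ⟨K, h1, h2, h3, h4⟩ := h
  obtain ⟨K', h1', h2', h3', h4'⟩ := h'
  refine ⟨K.trans K', h1'.comp h1, h2.comp h2', fun x hx ↦ ?_, fun x hx ↦ ?_⟩
  · rw [Equiv.trans_apply, h3 x hx, h3' x hx]
  · rw [Equiv.trans_apply, h4 x hx, h4' x hx]

/-- The invertible linear maps that send `B(0, ρ)` well inside `B(0, r)`. -/
def shrinkingUnits (E : Type*) [NormedAddCommGroup E] [InnerProductSpace ℝ E] (ρ r : ℝ) :
    Set (E →L[ℝ] E) := {C | IsUnit C ∧ ‖C‖ * ρ < r}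

lemma joinedIn_shrinkingUnits_smul (hρ : 0 < ρ) {C : E →L[ℝ] E} (hC : C ∈ shrinkingUnits E ρ r)
    {δ : ℝ} (hδ : 0 < δ) (hδ1 : δ ≤ 1) : JoinedIn (shrinkingUnits E ρ r) C (δ • C) := by
  refine JoinedIn.of_segment_subset ?_
  rintro _ ⟨a, b, ha, hb, hab, rfl⟩
  have hpos : 0 < a + b * δ := by
    rcases hb.eq_or_lt with rfl | hb
    · linarith
    · positivity
  have hle : a + b * δ ≤ 1 := by nlinarith
  rw [smul_smul, ← add_smul]
  refine ⟨hC.1.smul (Units.mk0 _ hpos.ne'), ?_⟩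
  rw [norm_smul, Real.norm_of_nonneg hpos.le]
  refine lt_of_le_of_lt ?_ hC.2
  exact mul_le_mul_of_nonneg_right (mul_le_of_le_one_left (norm_nonneg _) hle) hρ.le

lemma joinedIn_shrinkingUnits_of_isUnit (hρ : 0 < ρ) {C C' : E →L[ℝ] E}
    (hC : C ∈ shrinkingUnits E ρ r) (hC' : C' ∈ shrinkingUnits E ρ r)
    (h : JoinedIn {T : E →L[ℝ] E | IsUnit T} C C') : JoinedIn (shrinkingUnits E ρ r) C C' := by
  have hr : 0 < r := (by positivity : 0 ≤ ‖C‖ * ρ).trans_lt hC.2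
  obtain ⟨γ, hγ⟩ := h
  obtain ⟨M, hM0, hM⟩ := (isCompact_range γ.continuous).isBounded.exists_pos_norm_le
  have hδ : 0 < r / (r + ρ * M) := by positivity
  have hδ1 : r / (r + ρ * M) ≤ 1 := by
    rw [div_le_one (by positivity)]
    nlinarith [mul_pos hρ hM0]
  set δ := r / (r + ρ * M) with hδ_def
  refine (joinedIn_shrinkingUnits_smul hρ hC hδ hδ1).trans
    (JoinedIn.trans ?_ (joinedIn_shrinkingUnits_smul hρ hC' hδ hδ1).symm)
  refine ⟨γ.map (f := fun T ↦ δ • T) (by fun_prop), fun t ↦ ⟨(hγ t).smul (Units.mk0 _ hδ.ne'), ?_⟩⟩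
  have hb : ‖γ t‖ ≤ M := hM _ (mem_range_self t)
  have : ‖δ • γ t‖ * ρ ≤ δ * M * ρ := by
    rw [norm_smul, Real.norm_of_nonneg hδ.le]
    gcongr
  refine lt_of_le_of_lt this ?_
  rw [hδ_def, div_mul_eq_mul_div, div_mul_eq_mul_div, div_lt_iff₀ (by positivity)]
  nlinarith [mul_pos hr hr]

variable [FiniteDimensional ℝ E]

/-- A smooth perturbation of the identity by a map with Lipschitz constant less than `1` is a
diffeomorphism. -/
lemma exists_diffeo_of_lipschitz {g : E → E} {c : NNReal} (hg : ContDiff ℝ (⊤ : ℕ∞) g)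
    (hc : c < 1) (hL : LipschitzWith c g) :
    ∃ K : E ≃ E, ContDiff ℝ (⊤ : ℕ∞) K ∧ ContDiff ℝ (⊤ : ℕ∞) K.symm ∧ ∀ x, K x = x + g x := by
  have happ : ApproximatesLinearOn (fun x ↦ x + g x)
      ((ContinuousLinearEquiv.refl ℝ E : E ≃L[ℝ] E) : E →L[ℝ] E) univ c := by
    intro x _ y _
    have h : x + g x - (y + g y) - (x - y) = g x - g y := by abel
    simpa [h] using hL.norm_sub_le x y
  have hN : Subsingleton E ∨
      c < ‖((ContinuousLinearEquiv.refl ℝ E).symm : E →L[ℝ] E)‖₊⁻¹ := by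
    rcases subsingleton_or_nontrivial E with h | h
    · exact Or.inl h
    · right
      have : ‖((ContinuousLinearEquiv.refl ℝ E).symm : E →L[ℝ] E)‖₊ = 1 := by
        ext
        exact ContinuousLinearMap.norm_id
      rwa [this, inv_one]
  have hsm : ContDiff ℝ (⊤ : ℕ∞) fun x ↦ x + g x := contDiff_id.add hg
  have hunit : ∀ x, IsUnit (1 + fderiv ℝ g x) := fun x ↦ by
    have := isUnit_one_sub_of_norm_lt_one (x := -fderiv ℝ g x) (by
      rw [norm_neg]
      exact (norm_fderiv_le_of_lipschitz ℝ hL).trans_lt (by exact_mod_cast hc))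
    rwa [sub_neg_eq_add] at this
  choose u hu using hunit
  have hder : ∀ x, HasFDerivAt (happ.toHomeomorph _ hN)
      (ContinuousLinearEquiv.ofUnit (u x) : E →L[ℝ] E) x := fun x ↦ by
    have h : (ContinuousLinearEquiv.ofUnit (u x) : E →L[ℝ] E) = 1 + fderiv ℝ g x := hu x
    rw [h]
    exact (hasFDerivAt_id x).add (hg.differentiable (by simp) x).hasFDerivAt
  exact ⟨(happ.toHomeomorph _ hN).toEquiv, hsm,
    (happ.toHomeomorph _ hN).contDiff_symm hder hsm, fun x ↦ rfl⟩

lemma eventually_supportedDiffeoRel (hρ : 0 < ρ) {C : E →L[ℝ] E} (hC : C ∈ shrinkingUnits E ρ r) :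
    ∀ᶠ C' in 𝓝 C, SupportedDiffeoRel ρ r C C' := by
  obtain ⟨⟨u, rfl⟩, hr⟩ := hC
  obtain ⟨s, hs, hsr⟩ := exists_between hr
  have hs0 : 0 < s := (by positivity : 0 ≤ ‖(u : E →L[ℝ] E)‖ * ρ).trans_lt hs
  let f : ContDiffBump (0 : E) := ⟨s, r, hs0, hsr⟩
  have hfsm : ContDiff ℝ (⊤ : ℕ∞) fun x ↦ f x • x := f.contDiff.smul contDiff_id
  obtain ⟨L, hL⟩ := ContDiff.lipschitzWith_of_hasCompactSupport (𝕂 := ℝ)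
    (f := fun x ↦ f x • x) f.hasCompactSupport.smul_right hfsm (by simp)
  have hcont : Continuous fun C' : E →L[ℝ] E ↦
      ‖(C' - u) * (↑u⁻¹ : E →L[ℝ] E)‖₊ * L := by fun_prop
  have hev := hcont.tendsto (u : E →L[ℝ] E) |>.eventually_lt_const
    (show _ < (1 : NNReal) by simp)
  filter_upwards [hev] with C' hC'
  set D : E →L[ℝ] E := (C' - u) * (↑u⁻¹ : E →L[ℝ] E) with hD
  obtain ⟨K, h1, h2, h3⟩ := exists_diffeo_of_lipschitz (D.contDiff.comp hfsm) hC'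
    (D.lipschitz.comp hL)
  refine ⟨K, h1, h2, fun x hx ↦ ?_, fun x hx ↦ ?_⟩
  · have hf : f ((u : E →L[ℝ] E) x) = 1 := by
      refine f.one_of_mem_closedBall ?_
      rw [mem_closedBall_zero_iff]
      rw [mem_ball_zero_iff] at hx
      exact ((u : E →L[ℝ] E).le_opNorm x).trans
        ((mul_le_mul_of_nonneg_left hx.le (norm_nonneg _)).trans hs.le)
    have hDu : D ((u : E →L[ℝ] E) x) = C' x - (u : E →L[ℝ] E) x := by
      have : D * u = C' - u := by rw [hD, mul_assoc, Units.inv_mul, mul_one]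
      exact DFunLike.congr_fun this x
    rw [h3, Function.comp_apply, hf, one_smul, hDu, add_sub_cancel]
  · have hf : f x = 0 := f.zero_of_le_dist (by simpa using hx)
    simp [h3, hf]

lemma JoinedIn.supportedDiffeoRel (hρ : 0 < ρ) {C C' : E →L[ℝ] E}
    (h : JoinedIn (shrinkingUnits E ρ r) C C') : SupportedDiffeoRel ρ r C C' := by
  obtain ⟨γ, hγ⟩ := h
  have := PreconnectedSpace.induction₂' (fun s t ↦ SupportedDiffeoRel ρ r (γ s) (γ t))
    (fun s ↦ (γ.continuous.tendsto s |>.eventually (eventually_supportedDiffeoRel hρ (hγ s))).mono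
      fun t ht ↦ ⟨ht, ht.symm⟩) ⟨fun _ _ _ ↦ SupportedDiffeoRel.trans⟩ 0 1
  simpa using this

/-- A linear map sending the closed ball of radius `ρ` into the open ball of radius `r` has
operator norm less than `r / ρ`. -/
lemma opNorm_mul_lt_of_mapsTo (hρ : 0 < ρ) {C : E →L[ℝ] E}
    (h : MapsTo C (Metric.closedBall 0 ρ) (Metric.ball 0 r)) : ‖C‖ * ρ < r := by
  obtain ⟨z, hz, hmax⟩ := (isCompact_closedBall (0 : E) ρ).exists_isMaxOn
    ⟨0, Metric.mem_closedBall_self hρ.le⟩ (f := fun x ↦ ‖C x‖) (by fun_prop)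
  have hzr : ‖C z‖ < r := by simpa using h hz
  refine lt_of_le_of_lt ?_ hzr
  rw [← le_div_iff₀ hρ]
  refine C.opNorm_le_bound (by positivity) fun x ↦ ?_
  rcases eq_or_ne x 0 with rfl | hx
  · simp
  have hx0 : 0 < ‖x‖ := norm_pos_iff.2 hx
  have hmem : (ρ / ‖x‖) • x ∈ Metric.closedBall (0 : E) ρ := by
    rw [mem_closedBall_zero_iff, norm_smul, Real.norm_of_nonneg (by positivity),
      div_mul_cancel₀ _ hx0.ne']
  have := hmax hmem
  simp only [mem_ofPred_eq, map_smul, norm_smul, Real.norm_of_nonneg (div_pos hρ hx0).le] at this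
  rw [div_mul_eq_mul_div, div_le_iff₀ hx0] at this
  rw [div_mul_eq_mul_div, le_div_iff₀ hρ]
  linarith

end Diffeo


/-- If `A₁, A₂` have positive determinant and `A₁(B(0, θr))` is compactly contained in
`A₂(B(0, r))`, then there is a `C^∞` diffeomorphism of `ℝⁿ` equal to `A₁` on `B(0, θr)`
and to `A₂` outside `B(0, r)`. -/
theorem stmt8 {n : ℕ} (r θ : ℝ) (hr : 0 < r) (hθ : θ ∈ Set.Ioo (0 : ℝ) 1)
    (A₁ A₂ : Matrix (Fin n) (Fin n) ℝ) (hA₁ : 0 < A₁.det) (hA₂ : 0 < A₂.det)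
    (hcc : closure (Matrix.toEuclideanLin A₁ ''
        Metric.ball (0 : EuclideanSpace ℝ (Fin n)) (θ * r)) ⊆
      Matrix.toEuclideanLin A₂ '' Metric.ball (0 : EuclideanSpace ℝ (Fin n)) r) :
    ∃ H : EuclideanSpace ℝ (Fin n) ≃ EuclideanSpace ℝ (Fin n),
      ContDiff ℝ (⊤ : ℕ∞) ⇑H ∧ ContDiff ℝ (⊤ : ℕ∞) ⇑H.symm ∧
      (∀ x ∈ Metric.ball (0 : EuclideanSpace ℝ (Fin n)) (θ * r),
        H x = Matrix.toEuclideanLin A₁ x) ∧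
      (∀ x ∉ Metric.ball (0 : EuclideanSpace ℝ (Fin n)) r,
        H x = Matrix.toEuclideanLin A₂ x) := by
  obtain ⟨hθ0, hθ1⟩ := hθ
  have hρ : 0 < θ * r := mul_pos hθ0 hr
  have hu₂ : IsUnit A₂.det := hA₂.ne'.isUnit
  let Φ := Matrix.toEuclideanCLM (n := Fin n) (𝕜 := ℝ)
  have hΦcont : Continuous Φ := 
    LinearMap.continuous_of_finiteDimensional 
      { toFun := Φ, map_add' := map_add Φ, map_smul' := map_smul Φ }
  set B := A₂⁻¹ * A₁ with hB
  have hA₂B : A₂ * B = A₁ := by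
    rw [hB, ← Matrix.mul_assoc, Matrix.mul_nonsing_inv _ hu₂, Matrix.one_mul]
  have hBdet : 0 < B.det := by
    rw [← hA₂B, Matrix.det_mul] at hA₁
    exact (pos_iff_pos_of_mul_pos hA₁).1 hA₂
  have hunit : ∀ {M : Matrix (Fin n) (Fin n) ℝ}, 0 < M.det → IsUnit (Φ M) := fun hM ↦
    ((Matrix.isUnit_iff_isUnit_det _).2 hM.ne'.isUnit).map Φ
  have hleft : ∀ x, Φ A₂⁻¹ (Φ A₂ x) = x := fun x ↦ by
    have : Φ A₂⁻¹ * Φ A₂ = 1 := by rw [← map_mul, Matrix.nonsing_inv_mul _ hu₂, map_one]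
    exact DFunLike.congr_fun this x
  have hright : ∀ x, Φ A₂ (Φ A₂⁻¹ x) = x := fun x ↦ by
    have : Φ A₂ * Φ A₂⁻¹ = 1 := by rw [← map_mul, Matrix.mul_nonsing_inv _ hu₂, map_one]
    exact DFunLike.congr_fun this x
  have hmaps : MapsTo (Φ B) (Metric.closedBall 0 (θ * r)) (Metric.ball 0 r) := by
    intro x hx
    rw [← closure_ball _ hρ.ne'] at hx
    obtain ⟨y, hy, hyx⟩ := hcc (image_closure_subset_closure_image (Φ A₁).continuous
      (mem_image_of_mem _ hx))
    have hBx : Φ B x = y := by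
      rw [hB, map_mul]
      change Φ A₂⁻¹ (Φ A₁ x) = y
      rw [← hyx]
      exact hleft y
    rwa [hBx]
  have hBmem : Φ B ∈ shrinkingUnits (EuclideanSpace ℝ (Fin n)) (θ * r) r :=
    ⟨hunit hBdet, opNorm_mul_lt_of_mapsTo hρ hmaps⟩
  have h1mem : Φ 1 ∈ shrinkingUnits (EuclideanSpace ℝ (Fin n)) (θ * r) r := by
    refine ⟨hunit (by simp), opNorm_mul_lt_of_mapsTo hρ ?_⟩
    rw [map_one]
    exact Metric.closedBall_subset_ball (by nlinarith)
  have hpath : JoinedIn {T | IsUnit T} (Φ 1) (Φ B) :=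
    ((Matrix.joinedIn_posDet hBdet).map hΦcont).mono (by
      rintro _ ⟨M, hM, rfl⟩
      exact hunit hM)
  obtain ⟨K, hK, hK', hin, hout⟩ :=
    (joinedIn_shrinkingUnits_of_isUnit hρ h1mem hBmem hpath).supportedDiffeoRel hρ
  refine ⟨K.trans ⟨Φ A₂, Φ A₂⁻¹, hleft, hright⟩, (Φ A₂).contDiff.comp hK,
    hK'.comp (Φ A₂⁻¹).contDiff, fun x hx ↦ ?_, fun x hx ↦ ?_⟩
  · have hKx : K x = Φ B x := by simpa using hin x hx
    change Φ A₂ (K x) = Φ A₁ x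
    have hmul : Φ A₁ = Φ A₂ * Φ B := by rw [← map_mul, hA₂B]
    rw [hKx, hmul]
    rfl
  · change Φ A₂ (K x) = Φ A₂ x
    rw [hout x hx]
end

section
/- Let Ω ⊂ ℝⁿ be a bounded domain and f ∈ L¹(Ω) with f > 0 a.e. and ∫_Ω f = |Ω|. Then for any ε > 0 there exists a compact set K ⊂ Ω with |Ω \ K| < ε and a C^∞ diffeomorphism Ψ of Ω onto itself that is the identity on a neighborhood of ∂Ω and satisfies |det DΨ(x) − f(x)| < ε f(x) for all x ∈ K. -/
open MeasureTheory
open Set Filter Topology Metric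

section Diffeo

variable {E : Type*} [NormedAddCommGroup E] [NormedSpace ℝ E]

/-- A smooth diffeomorphism of `E` that is the identity outside a compact subset of `U`. -/
structure IsCompactDiffeo (U : Set E) (Φ : E ≃ E) : Prop where
  smooth : ContDiff ℝ (⊤ : ℕ∞) Φ
  smooth_symm : ContDiff ℝ (⊤ : ℕ∞) Φ.symm
  support : ∃ K, IsCompact K ∧ K ⊆ U ∧ ∀ x ∉ K, Φ x = x

namespace IsCompactDiffeo

variable {U V : Set E} {Φ Ψ : E ≃ E}

lemma refl (U : Set E) : IsCompactDiffeo U (Equiv.refl E) :=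
  ⟨contDiff_id, contDiff_id, ∅, isCompact_empty, empty_subset _, fun _ _ => rfl⟩

lemma mono (h : IsCompactDiffeo U Φ) (hUV : U ⊆ V) : IsCompactDiffeo V Φ :=
  ⟨h.smooth, h.smooth_symm, let ⟨K, hK, hKU, hΦ⟩ := h.support; ⟨K, hK, hKU.trans hUV, hΦ⟩⟩

lemma symm (h : IsCompactDiffeo U Φ) : IsCompactDiffeo U Φ.symm :=
  ⟨h.smooth_symm, h.smooth, let ⟨K, hK, hKU, hΦ⟩ := h.support
    ⟨K, hK, hKU, fun x hx => by rw [Equiv.symm_apply_eq, hΦ x hx]⟩⟩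

lemma trans (h : IsCompactDiffeo U Φ) (h' : IsCompactDiffeo U Ψ) :
    IsCompactDiffeo U (Φ.trans Ψ) := by
  obtain ⟨K, hK, hKU, hΦ⟩ := h.support
  obtain ⟨L, hL, hLU, hΨ⟩ := h'.support
  refine ⟨h'.smooth.comp h.smooth, h.smooth_symm.comp h'.smooth_symm,
    K ∪ L, hK.union hL, union_subset hKU hLU, fun x hx => ?_⟩
  rw [mem_union, not_or] at hx
  rw [Equiv.trans_apply, hΦ x hx.1, hΨ x hx.2]

lemma eventually_eq (h : IsCompactDiffeo U Φ) {x : E} (hx : x ∉ U) : ∀ᶠ z in 𝓝 x, Φ z = z := by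
  obtain ⟨K, hK, hKU, hΦ⟩ := h.support
  filter_upwards [hK.isClosed.isOpen_compl.mem_nhds fun hxK => hx (hKU hxK)] with z hz
    using hΦ z hz

lemma apply_eq (h : IsCompactDiffeo U Φ) {x : E} (hx : x ∉ U) : Φ x = x :=
  (h.eventually_eq hx).self_of_nhds

lemma image_eq (h : IsCompactDiffeo U Φ) : Φ '' U = U := by
  have key : ∀ {Θ : E ≃ E}, IsCompactDiffeo U Θ → ∀ x ∈ U, Θ x ∈ U := by
    intro Θ hΘ x hx
    by_contra hn
    exact hn ((Θ.injective (hΘ.apply_eq hn)).symm ▸ hx)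
  ext y
  exact ⟨fun ⟨x, hx, hxy⟩ => hxy ▸ key h x hx, fun hy => ⟨Φ.symm y, key h.symm y hy, by simp⟩⟩

lemma isUnit_fderiv (h : IsCompactDiffeo U Φ) (x : E) : IsUnit (fderiv ℝ Φ x) := by
  have hd : ∀ {Θ : E ≃ E}, IsCompactDiffeo U Θ → ∀ x,
      (fderiv ℝ Θ.symm (Θ x)) * fderiv ℝ Θ x = 1 := by
    intro Θ hΘ x
    have h1 := ((hΘ.smooth_symm.differentiable (by simp) (Θ x)).hasFDerivAt).comp x
      (hΘ.smooth.differentiable (by simp) x).hasFDerivAt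
    rw [Equiv.symm_comp_self] at h1
    exact h1.unique (hasFDerivAt_id x)
  refine ⟨⟨fderiv ℝ Φ x, fderiv ℝ Φ.symm (Φ x), ?_, hd h x⟩, rfl⟩
  simpa using hd h.symm (Φ x)

/-- A small Lipschitz perturbation of the identity is a diffeomorphism. -/
lemma exists_id_add [CompleteSpace E] {v : E → E} (hv : ContDiff ℝ (⊤ : ℕ∞) v)
    (hl : LipschitzWith (1 / 2) v)
    (hs : ∃ K, IsCompact K ∧ K ⊆ U ∧ ∀ x ∉ K, v x = 0) :
    ∃ Φ : E ≃ E, IsCompactDiffeo U Φ ∧ ∀ x, Φ x = x + v x := by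
  have ha : ApproximatesLinearOn (fun x => x + v x) ((ContinuousLinearEquiv.refl ℝ E : E ≃L[ℝ] E) :
      E →L[ℝ] E) univ (1 / 2) := by
    intro x _ y _
    have := hl.dist_le_mul x y
    rw [dist_eq_norm, dist_eq_norm] at this
    change ‖(x + v x) - (y + v y) - (x - y)‖ ≤ _
    rwa [show (x + v x) - (y + v y) - (x - y) = v x - v y by abel]
  have hc : Subsingleton E ∨ (1 / 2 : NNReal) <
      ‖((ContinuousLinearEquiv.refl ℝ E).symm : E →L[ℝ] E)‖₊⁻¹ := by
    rcases subsingleton_or_nontrivial E with h | h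
    · exact Or.inl h
    · right
      have : ‖((ContinuousLinearEquiv.refl ℝ E).symm : E →L[ℝ] E)‖₊ = 1 := by
        simp
      rw [this, inv_one]
      exact NNReal.half_lt_self one_ne_zero
  let e := ha.toHomeomorph _ hc
  have he : ∀ x, e x = x + v x := fun x => rfl
  have hsm : ContDiff ℝ (⊤ : ℕ∞) e := contDiff_id.add hv
  have hu : ∀ a, IsUnit (1 + fderiv ℝ v a) := fun a => by
    rw [← sub_neg_eq_add]
    refine isUnit_one_sub_of_norm_lt_one ?_
    rw [norm_neg]
    refine (norm_fderiv_le_of_lipschitz ℝ hl).trans_lt ?_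
    norm_num
  refine ⟨e.toEquiv, ⟨hsm, ?_, ?_⟩, he⟩
  · refine e.contDiff_symm (f₀' := fun a => ContinuousLinearEquiv.unitsEquiv ℝ E (hu a).unit)
      (fun a => ?_) hsm
    exact (hasFDerivAt_id a).add (hv.differentiable (by simp) a).hasFDerivAt
  · obtain ⟨K, hK, hKU, h⟩ := hs
    exact ⟨K, hK, hKU, fun x hx => by simp [he, h x hx]⟩

end IsCompactDiffeo

variable [FiniteDimensional ℝ E]

lemma exists_smooth_cutoff {K U : Set E} (hK : IsCompact K) (hU : IsOpen U) (hKU : K ⊆ U) :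
    ∃ χ : E → ℝ, ContDiff ℝ (⊤ : ℕ∞) χ ∧ (∀ᶠ x in 𝓝ˢ K, χ x = 1) ∧
      ∃ L, IsCompact L ∧ L ⊆ U ∧ ∀ x ∉ L, χ x = 0 := by
  obtain ⟨L, hL, hKL, hLU⟩ := exists_compact_between hK hU hKU
  obtain ⟨χ, h1, h0, -⟩ := exists_contMDiffMap_one_nhds_of_subset_interior
    (modelWithCornersSelf ℝ E) (n := (⊤ : ℕ∞)) hK.isClosed hKL
  exact ⟨χ, χ.contMDiff.contDiff, h1, L, hL, hLU, h0⟩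

omit [FiniteDimensional ℝ E] in
lemma exists_lipschitz_of_compact_support {F : Type*} [NormedAddCommGroup F] [NormedSpace ℝ F]
    {v : E → F} (hv : ContDiff ℝ (⊤ : ℕ∞) v)
    {L : Set E} (hL : IsCompact L) (h0 : ∀ x ∉ L, v x = 0) : ∃ C, LipschitzWith C v :=
  hv.lipschitzWith_of_hasCompactSupport (HasCompactSupport.intro hL h0) (by simp)

lemma eventually_exists_translation {U : Set E} (hU : IsOpen U) {a : E} (ha : a ∈ U) :
    ∀ᶠ b in 𝓝 a, ∃ Φ, IsCompactDiffeo U Φ ∧ ∀ᶠ z in 𝓝 a, Φ z = z + (b - a) := by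
  obtain ⟨χ, hχ, h1, L, hL, hLU, h0⟩ :=
    exists_smooth_cutoff (isCompact_singleton (x := a)) hU (singleton_subset_iff.2 ha)
  obtain ⟨C, hC⟩ := exists_lipschitz_of_compact_support hχ hL h0
  have : ∀ᶠ b in 𝓝 a, C * ‖b - a‖₊ < 1 / 2 := by
    have : Tendsto (fun b => C * ‖b - a‖₊) (𝓝 a) (𝓝 (C * ‖a - a‖₊)) :=
      (by fun_prop : Continuous fun b => C * ‖b - a‖₊).tendsto a
    exact this.eventually_lt_const (by simp)
  filter_upwards [this] with b hb
  obtain ⟨Φ, hΦ, h⟩ := IsCompactDiffeo.exists_id_add (U := U) (v := fun z => χ z • (b - a))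
    (hχ.smul contDiff_const) (by
      refine LipschitzWith.weaken (K := C * ‖b - a‖₊)
        (LipschitzWith.of_dist_le_mul fun x y => ?_) hb.le
      rw [dist_eq_norm, ← sub_smul, norm_smul, NNReal.coe_mul, coe_nnnorm]
      have := hC.dist_le_mul x y
      rw [dist_eq_norm (χ x)] at this
      nlinarith [norm_nonneg (b - a)]) ⟨L, hL, hLU, fun x hx => by simp [h0 x hx]⟩
  refine ⟨Φ, hΦ, ?_⟩
  rw [nhdsSet_singleton] at h1
  filter_upwards [h1] with z hz
  rw [h, hz, one_smul]

lemma exists_translation {U V : Set E} (hU : IsOpen U) (hV : IsPreconnected V) (hVU : V ⊆ U)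
    {a b : E} (ha : a ∈ V) (hb : b ∈ V) :
    ∃ Φ, IsCompactDiffeo U Φ ∧ ∀ᶠ z in 𝓝 a, Φ z = z + (b - a) := by
  refine hV.induction₂
    (fun a b => ∃ Φ, IsCompactDiffeo U Φ ∧ ∀ᶠ z in 𝓝 a, Φ z = z + (b - a)) ?_ ?_ ?_ ha hb
  · exact fun x hx => (eventually_exists_translation hU (hVU hx)).filter_mono nhdsWithin_le_nhds
  · rintro x y z - - - ⟨Φ, hΦ, h⟩ ⟨Ψ, hΨ, h'⟩
    refine ⟨_, hΦ.trans hΨ, ?_⟩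
    have : Tendsto Φ (𝓝 x) (𝓝 y) := by
      have := hΦ.smooth.continuous.tendsto x
      rwa [h.self_of_nhds, add_sub_cancel] at this
    filter_upwards [h, this.eventually h'] with w hw hw'
    rw [Equiv.trans_apply, hw', hw]
    abel
  · rintro x y - - ⟨Φ, hΦ, h⟩
    refine ⟨_, hΦ.symm, ?_⟩
    have : Tendsto Φ.symm (𝓝 y) (𝓝 x) := by
      have := hΦ.smooth_symm.continuous.tendsto y
      rwa [(Equiv.symm_apply_eq Φ).2 (by rw [h.self_of_nhds, add_sub_cancel] : y = Φ x)] at this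
    filter_upwards [this.eventually h] with w hw
    rw [Equiv.apply_symm_apply] at hw
    nth_rw 2 [hw]
    abel

/-- Homotheties with ratio close to one. -/
lemma exists_homothety_near_one {U Q : Set E} (hU : IsOpen U) (hQ : IsCompact Q) (hQU : Q ⊆ U)
    (c : E) : ∃ δ > (0 : ℝ), ∀ t, 1 - δ ≤ t → t ≤ 1 →
      ∃ Φ, IsCompactDiffeo U Φ ∧ ∀ z ∈ Q, Φ z = c + t • (z - c) := by
  obtain ⟨χ, hχ, h1, L, hL, hLU, h0⟩ := exists_smooth_cutoff hQ hU hQU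
  have hw : ContDiff ℝ (⊤ : ℕ∞) (fun z => χ z • (z - c)) := hχ.smul (contDiff_id.sub contDiff_const)
  obtain ⟨C, hC⟩ := exists_lipschitz_of_compact_support hw hL fun x hx => by simp [h0 x hx]
  refine ⟨1 / (2 * (C + 1)), by positivity, fun t ht ht1 => ?_⟩
  obtain ⟨Φ, hΦ, h⟩ := IsCompactDiffeo.exists_id_add (U := U)
    (v := fun z => (t - 1) • (χ z • (z - c))) (contDiff_const.smul hw) (by
      refine LipschitzWith.of_dist_le_mul fun x y => ?_
      have hd := hC.dist_le_mul x y
      rw [dist_smul₀, Real.norm_eq_abs, abs_of_nonpos (by linarith)]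
      have hb : -(t - 1) * C ≤ 1 / 2 := by
        have hC0 : (0 : ℝ) ≤ C := C.2
        calc -(t - 1) * C ≤ 1 / (2 * (C + 1)) * (C + 1) := by
              apply mul_le_mul <;> linarith
          _ = 1 / 2 := by field_simp
      calc -(t - 1) * dist (χ x • (x - c)) (χ y • (y - c)) ≤ -(t - 1) * (C * dist x y) := by
            gcongr; linarith
        _ = (-(t - 1) * C) * dist x y := by ring
        _ ≤ 1 / 2 * dist x y := by gcongr
        _ = _ := by simp) ⟨L, hL, hLU, fun x hx => by simp [h0 x hx]⟩
  refine ⟨Φ, hΦ, fun z hz => ?_⟩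
  rw [h, h1.self_of_nhdsSet z hz]
  module

lemma exists_homothety {U Q : Set E} (hU : IsOpen U) (hQ : IsCompact Q) (hQU : Q ⊆ U)
    {c : E} (hc : StarConvex ℝ c Q) {t : ℝ} (ht : 0 < t) (ht1 : t ≤ 1) :
    ∃ Φ, IsCompactDiffeo U Φ ∧ ∀ z ∈ Q, Φ z = c + t • (z - c) := by
  obtain ⟨δ, hδ, h⟩ := exists_homothety_near_one hU hQ hQU c
  have hlim : Tendsto (fun m : ℕ => t ^ ((m : ℝ)⁻¹)) atTop (𝓝 1) := by
    simpa [Function.comp_def] using (Real.continuousAt_const_rpow ht.ne').tendsto.comp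
      (tendsto_inv_atTop_nhds_zero_nat (𝕜 := ℝ))
  obtain ⟨m, hm, hm0⟩ := ((hlim.eventually_const_le (sub_lt_self 1 hδ)).and
    (eventually_ne_atTop 0)).exists
  set s := t ^ ((m : ℝ)⁻¹) with hs
  have hs0 : 0 ≤ s := by positivity
  have hs1 : s ≤ 1 := Real.rpow_le_one ht.le ht1 (by positivity)
  have hsm : s ^ m = t := Real.rpow_inv_natCast_pow ht.le hm0
  obtain ⟨Φ, hΦ, hΦQ⟩ := h s hm hs1
  have key : ∀ k : ℕ, ∃ Ψ, IsCompactDiffeo U Ψ ∧ ∀ z ∈ Q, Ψ z = c + s ^ k • (z - c) := by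
    intro k
    induction k with
    | zero => exact ⟨_, .refl U, fun z _ => by simp⟩
    | succ k ih =>
      obtain ⟨Ψ, hΨ, hΨQ⟩ := ih
      refine ⟨_, hΨ.trans hΦ, fun z hz => ?_⟩
      have hmem : Ψ z ∈ Q := by
        rw [hΨQ z hz]
        have := hc.add_smul_sub_mem hz (pow_nonneg hs0 k) (pow_le_one₀ hs0 hs1)
        exact this
      rw [Equiv.trans_apply, hΦQ _ hmem, hΨQ z hz, pow_succ']
      module
  obtain ⟨Ψ, hΨ, hΨQ⟩ := key m
  exact ⟨Ψ, hΨ, fun z hz => by rw [hΨQ z hz, hsm]⟩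

/-- Simultaneous homotheties of finitely many disjoint compact star-shaped sets. -/
lemma exists_homotheties {ι : Type*} (J : Finset ι) {Q : ι → Set E} {c : ι → E} {t : ι → ℝ}
    (hQ : ∀ j ∈ J, IsCompact (Q j)) (hc : ∀ j ∈ J, StarConvex ℝ (c j) (Q j))
    (ht : ∀ j ∈ J, 0 < t j) (ht1 : ∀ j ∈ J, t j ≤ 1) (hd : (J : Set ι).PairwiseDisjoint Q)
    {U : Set E} (hU : IsOpen U) (hQU : ∀ j ∈ J, Q j ⊆ U) :
    ∃ Φ, IsCompactDiffeo U Φ ∧ ∀ j ∈ J, ∀ z ∈ Q j, Φ z = c j + t j • (z - c j) := by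
  classical
  induction J using Finset.induction_on generalizing U with
  | empty => exact ⟨_, .refl U, by simp⟩
  | insert j J hj ih =>
    simp only [Finset.forall_mem_insert] at hQ hc ht ht1 hQU
    have hdj : ∀ i ∈ J, Disjoint (Q i) (Q j) := fun i hi =>
      hd (by simp [hi]) (by simp) (fun h => hj (h ▸ hi))
    obtain ⟨Φ, hΦ, h⟩ := ih hQ.2 hc.2 ht.2 ht1.2 (hd.subset (by simp)) (U := U \ Q j)
      (hU.sdiff hQ.1.isClosed) (fun i hi => subset_sdiff.2 ⟨hQU.2 i hi, hdj i hi⟩)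
    have hcl : IsClosed (⋃ i ∈ J, Q i) :=
      J.finite_toSet.isClosed_biUnion fun i hi => (hQ.2 i hi).isClosed
    obtain ⟨Ψ, hΨ, h'⟩ := exists_homothety (U := U \ ⋃ i ∈ J, Q i) (hU.sdiff hcl) hQ.1
      (subset_sdiff.2 ⟨hQU.1, disjoint_iUnion₂_right.2 fun i hi => (hdj i hi).symm⟩)
      hc.1 ht.1 ht1.1
    refine ⟨_, (hΨ.mono sdiff_subset).trans (hΦ.mono sdiff_subset), ?_⟩
    simp only [Finset.forall_mem_insert]
    constructor
    · intro z hz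
      rw [Equiv.trans_apply, h' z hz]
      refine hΦ.apply_eq fun hn => hn.2 ?_
      exact hc.1.add_smul_sub_mem hz ht.1.le ht1.1
    · intro i hi z hz
      rw [Equiv.trans_apply, hΨ.apply_eq fun hn => hn.2 (mem_iUnion₂_of_mem hi hz), h i hi z hz]

omit [FiniteDimensional ℝ E] in
lemma exists_mem_notMem_finset_of_mem_nhds [Nontrivial E] {V : Set E} {a : E} (hV : V ∈ 𝓝 a)
    (F : Finset E) : ∃ z ∈ V, z ∉ F := by
  have : (V \ (F : Set E)).Nonempty :=
    ((infinite_of_mem_nhds a hV).sdiff F.finite_toSet).nonempty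
  obtain ⟨z, hz, hzF⟩ := this
  exact ⟨z, hz, by simpa using hzF⟩

/-- `S` is carried onto `T` by a compactly supported diffeomorphism of `U` that is a translation
near each point of `S`. -/
def CanMove (U : Set E) (S T : Finset E) : Prop :=
  ∃ Φ : E ≃ E, IsCompactDiffeo U Φ ∧ Φ '' S = T ∧ ∀ x ∈ S, ∀ᶠ z in 𝓝 x, Φ z = z + (Φ x - x)

namespace CanMove

variable {U : Set E} {S T R : Finset E}

omit [FiniteDimensional ℝ E] in
lemma refl (U : Set E) (S : Finset E) : CanMove U S S :=
  ⟨_, .refl U, by simp, fun x _ => by simp⟩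

omit [FiniteDimensional ℝ E] in
lemma symm (h : CanMove U S T) : CanMove U T S := by
  obtain ⟨Φ, hΦ, himg, h⟩ := h
  refine ⟨_, hΦ.symm, ?_, fun y hy => ?_⟩
  · rw [← himg, Equiv.symm_image_image]
  obtain ⟨x, hx, rfl⟩ : y ∈ Φ '' S := himg ▸ hy
  have ht := hΦ.smooth_symm.continuous.tendsto (Φ x)
  rw [Equiv.symm_apply_apply] at ht ⊢
  filter_upwards [ht.eventually (h x hx)] with w hw
  rw [Equiv.apply_symm_apply] at hw
  nth_rw 2 [hw]
  abel

omit [FiniteDimensional ℝ E] in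
lemma trans (h : CanMove U S T) (h' : CanMove U T R) : CanMove U S R := by
  obtain ⟨Φ, hΦ, himg, h⟩ := h
  obtain ⟨Ψ, hΨ, himg', h'⟩ := h'
  refine ⟨_, hΦ.trans hΨ, ?_, fun x hx => ?_⟩
  · rw [← himg', ← himg, ← image_comp, Equiv.coe_trans]
  have hy : Φ x ∈ T := by
    have : Φ x ∈ Φ '' S := mem_image_of_mem _ hx
    rwa [himg] at this
  filter_upwards [h x hx, (hΦ.smooth.continuous.tendsto x).eventually (h' _ hy)] with z hz hz'
  rw [Equiv.trans_apply, Equiv.trans_apply, hz', hz]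
  abel

variable [DecidableEq E]

lemma insert_of_segment (hU : IsOpen U) {F : Finset E} {x y : E}
    (hs : segment ℝ x y ⊆ U \ F) : CanMove U (insert x F) (insert y F) := by
  obtain ⟨Φ, hΦ, h⟩ := exists_translation (hU.sdiff F.finite_toSet.isClosed)
    (convex_segment x y).isPreconnected hs (left_mem_segment ℝ x y) (right_mem_segment ℝ x y)
  have hxy : Φ x = y := by rw [h.self_of_nhds, add_sub_cancel]
  have hF : ∀ z ∈ F, ∀ᶠ w in 𝓝 z, Φ w = w := fun z hz => hΦ.eventually_eq fun hn => hn.2 hz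
  refine ⟨Φ, hΦ.mono sdiff_subset, ?_, fun z hz => ?_⟩
  · rw [Finset.coe_insert, Finset.coe_insert, image_insert_eq, hxy]
    congr 1
    have : EqOn Φ id F := fun z hz => (hF z hz).self_of_nhds
    rw [this.image_eq, image_id]
  · rcases Finset.mem_insert.1 hz with rfl | hz
    · rwa [hxy]
    · filter_upwards [hF z hz] with w hw
      rw [hw, (hF z hz).self_of_nhds, sub_self, add_zero]

lemma insert_of_convex (hU : IsOpen U) {F : Finset E} {B : Set E} {a : E} (hB : Convex ℝ B)
    (hBU : B ⊆ U) (haB : a ∈ B) (hF : ∀ p ∈ F, p ∈ B → p = a) {x y : E} (hx : x ∈ B)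
    (hxF : x ∉ F) (hy : y ∈ B) (hyF : y ∉ F) : CanMove U (insert x F) (insert y F) := by
  by_cases h : a ∈ F ∧ a ∈ segment ℝ x y
  · obtain ⟨haF, hs⟩ := h
    have hxa : x ≠ a := fun h => hxF (h ▸ haF)
    have hya : y ≠ a := fun h => hyF (h ▸ haF)
    have hw := mem_segment_iff_wbtw.1 hs
    have h1 : CanMove U (insert a (insert x (F.erase a))) (insert y (insert x (F.erase a))) := by
      refine insert_of_segment hU fun z hz => ⟨hBU (hB.segment_subset haB hy hz), fun hzF => ?_⟩
      rcases Finset.mem_insert.1 (Finset.mem_coe.1 hzF) with rfl | hzF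
      · exact hxa (hw.swap_left_iff.1 (mem_segment_iff_wbtw.1 hz))
      · exact Finset.ne_of_mem_erase hzF
          (hF z (Finset.mem_of_mem_erase hzF) (hB.segment_subset haB hy hz))
    have h2 : CanMove U (insert x (insert y (F.erase a))) (insert a (insert y (F.erase a))) := by
      refine insert_of_segment hU fun z hz => ⟨hBU (hB.segment_subset hx haB hz), fun hzF => ?_⟩
      rcases Finset.mem_insert.1 (Finset.mem_coe.1 hzF) with rfl | hzF
      · exact hya (hw.swap_right_iff.1 (mem_segment_iff_wbtw.1 hz)).symm
      · exact Finset.ne_of_mem_erase hzF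
          (hF z (Finset.mem_of_mem_erase hzF) (hB.segment_subset hx haB hz))
    rw [Finset.insert_comm a x, Finset.insert_erase haF] at h1
    rw [Finset.insert_comm a y, Finset.insert_erase haF, Finset.insert_comm x y] at h2
    exact h1.trans h2
  · refine insert_of_segment hU fun z hz => ?_
    have hzB := hB.segment_subset hx hy hz
    exact ⟨hBU hzB, fun hzF => h (hF z hzF hzB ▸ ⟨hzF, hz⟩)⟩

lemma insert_of_isPreconnected [Nontrivial E] (hU : IsOpen U) (hc : IsPreconnected U)
    {F : Finset E} {x y : E} (hx : x ∈ U) (hxF : x ∉ F) (hy : y ∈ U) (hyF : y ∉ F) :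
    CanMove U (insert x F) (insert y F) := by
  obtain ⟨V, hV, W, hW, h⟩ := hc.induction₂
    (fun a b => ∃ V ∈ 𝓝 a, ∃ W ∈ 𝓝 b, ∀ z ∈ V, z ∉ F → ∀ w ∈ W, w ∉ F →
      CanMove U (insert z F) (insert w F)) (fun a ha => by
        have h1 : ∀ᶠ r in 𝓝[>] (0 : ℝ), ball a r ⊆ U := by
          obtain ⟨r, hr, hrU⟩ := Metric.isOpen_iff.1 hU a ha
          filter_upwards [Ioo_mem_nhdsGT hr] with s hs using (ball_subset_ball hs.2.le).trans hrU
        have h2 : ∀ᶠ r in 𝓝[>] (0 : ℝ), ∀ p ∈ F, p ∈ ball a r → p = a := by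
          rw [Filter.eventually_all_finset]
          intro p _
          by_cases hp : p = a
          · simp [hp]
          · filter_upwards [Ioo_mem_nhdsGT (dist_pos.2 hp)] with s hs hps
            exact absurd (mem_ball.1 hps) hs.2.le.not_gt
        obtain ⟨r, ⟨hr1, hr2⟩, hr0⟩ := ((h1.and h2).and self_mem_nhdsWithin).exists
        have hr0 : 0 < r := hr0
        filter_upwards [mem_nhdsWithin_of_mem_nhds (ball_mem_nhds a hr0)] with b hb
        exact ⟨ball a r, ball_mem_nhds a hr0, ball a r, isOpen_ball.mem_nhds hb,
          fun z hz hzF w hw hwF => insert_of_convex hU (convex_ball a r) hr1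
            (mem_ball_self hr0) hr2 hz hzF hw hwF⟩)
      (fun a b c _ _ _ ⟨V, hV, W, hW, h⟩ ⟨V', hV', W', hW', h'⟩ => by
        obtain ⟨z, ⟨hz, hz'⟩, hzF⟩ :=
          exists_mem_notMem_finset_of_mem_nhds (inter_mem hW hV') F
        exact ⟨V, hV, W', hW', fun v hv hvF w hw hwF =>
          (h v hv hvF z hz hzF).trans (h' z hz' hzF w hw hwF)⟩)
      (fun a b _ _ ⟨V, hV, W, hW, h⟩ => ⟨W, hW, V, hV, fun z hz hzF w hw hwF =>
        (h w hw hwF z hz hzF).symm⟩) hx hy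
  exact h x (mem_of_mem_nhds hV) hxF y (mem_of_mem_nhds hW) hyF

omit [DecidableEq E] in
lemma exists_of_card_le [Nontrivial E] (hU : IsOpen U) (hc : IsPreconnected U)
    (hS : (S : Set E) ⊆ U) (hT : (T : Set E) ⊆ U) (hST : S.card ≤ T.card) :
    ∃ T' ⊆ T, CanMove U S T' := by
  classical
  induction hk : (S \ T).card generalizing S with
  | zero => exact ⟨S, Finset.sdiff_eq_empty_iff_subset.1 (Finset.card_eq_zero.1 hk), .refl U S⟩
  | succ k ih =>
    obtain ⟨x, hx⟩ : (S \ T).Nonempty := Finset.card_pos.1 (by omega)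
    obtain ⟨y, hy⟩ : (T \ S).Nonempty := by
      have h1 := Finset.card_sdiff_add_card_inter S T
      have h2 := Finset.card_sdiff_add_card_inter T S
      rw [Finset.inter_comm] at h2
      exact Finset.card_pos.1 (by omega)
    rw [Finset.mem_sdiff] at hx hy
    have hyE : y ∉ S.erase x := fun h => hy.2 (Finset.mem_of_mem_erase h)
    have hm : CanMove U (insert x (S.erase x)) (insert y (S.erase x)) :=
      insert_of_isPreconnected hU hc (hS hx.1) (by simp) (hT hy.1) hyE
    rw [Finset.insert_erase hx.1] at hm
    obtain ⟨T', hT', h⟩ := ih (S := insert y (S.erase x))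
      (by
        rw [Finset.coe_insert]
        exact insert_subset (hT hy.1) ((Finset.coe_subset.2 (Finset.erase_subset _ _)).trans hS))
      (by rwa [Finset.card_insert_of_notMem hyE, Finset.card_erase_add_one hx.1])
      (by
        rw [Finset.insert_sdiff_of_mem _ hy.1, Finset.erase_sdiff_comm,
          Finset.card_erase_of_mem (Finset.mem_sdiff.2 hx), hk, Nat.add_sub_cancel])
    exact ⟨T', hT', hm.trans h⟩

end CanMove

end Diffeo

section Cube

variable {n : ℕ}

/-- The closed axis-parallel cube with centre `c` and side length `2 * h`. -/
def euclideanCube (c : EuclideanSpace ℝ (Fin n)) (h : ℝ) : Set (EuclideanSpace ℝ (Fin n)) :=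
  {z | ∀ i, |z i - c i| ≤ h}

lemma euclideanCube_subset_closedBall (c : EuclideanSpace ℝ (Fin n)) {h : ℝ} (hh : 0 ≤ h) :
    euclideanCube c h ⊆ closedBall c (√n * h) := by
  intro z hz
  rw [mem_closedBall, EuclideanSpace.dist_eq]
  calc √(∑ i, dist (z i) (c i) ^ 2) ≤ √(∑ _i : Fin n, h ^ 2) := by
        refine Real.sqrt_le_sqrt (Finset.sum_le_sum fun i _ => ?_)
        exact pow_le_pow_left₀ dist_nonneg (hz i) 2
    _ = √n * h := by simp [Real.sqrt_sq hh]

lemma isClosed_euclideanCube (c : EuclideanSpace ℝ (Fin n)) (h : ℝ) :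
    IsClosed (euclideanCube c h) := by
  have : euclideanCube c h = ⋂ i, {z | |z i - c i| ≤ h} := by ext; simp [euclideanCube]
  rw [this]
  exact isClosed_iInter fun i => isClosed_le (by fun_prop) continuous_const

lemma isCompact_euclideanCube (c : EuclideanSpace ℝ (Fin n)) {h : ℝ} (hh : 0 ≤ h) :
    IsCompact (euclideanCube c h) :=
  (isCompact_closedBall c _).of_isClosed_subset (isClosed_euclideanCube c h)
    (euclideanCube_subset_closedBall c hh)

lemma mem_euclideanCube_self (c : EuclideanSpace ℝ (Fin n)) {h : ℝ} (hh : 0 ≤ h) :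
    c ∈ euclideanCube c h := fun i => by simpa

lemma euclideanCube_mono (c : EuclideanSpace ℝ (Fin n)) {h h' : ℝ} (hh : h ≤ h') :
    euclideanCube c h ⊆ euclideanCube c h' := fun _ hz i => (hz i).trans hh

lemma add_smul_mem_euclideanCube {c c' z : EuclideanSpace ℝ (Fin n)} {h h' t : ℝ}
    (hz : z ∈ euclideanCube c h) (ht : 0 ≤ t) (hth : t * h ≤ h') :
    c' + t • (z - c) ∈ euclideanCube c' h' := by
  intro i
  have : (c' + t • (z - c)) i - c' i = t * (z i - c i) := by simp
  rw [this, abs_mul, abs_of_nonneg ht]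
  exact (mul_le_mul_of_nonneg_left (hz i) ht).trans hth

lemma starConvex_euclideanCube (c : EuclideanSpace ℝ (Fin n)) {h : ℝ} (hh : 0 ≤ h) :
    StarConvex ℝ c (euclideanCube c h) := by
  intro y hy a b _ hb hab
  have : a • c + b • y = c + b • (y - c) := by
    rw [eq_sub_of_add_eq hab]
    module
  rw [this]
  exact add_smul_mem_euclideanCube hy hb (mul_le_of_le_one_left hh (by linarith))

lemma euclideanCube_mem_nhds {c z : EuclideanSpace ℝ (Fin n)} {h h' : ℝ}
    (hz : z ∈ euclideanCube c h) (hh : h < h') : euclideanCube c h' ∈ 𝓝 z := by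
  refine Filter.eventually_all.2 fun i => ?_
  have : ContinuousAt (fun w : EuclideanSpace ℝ (Fin n) => |w i - c i|) z := by fun_prop
  filter_upwards [this.eventually_lt_const ((hz i).trans_lt hh)] with w hw using hw.le

lemma eventually_forall_mem_euclideanCube {c : EuclideanSpace ℝ (Fin n)}
    {p : EuclideanSpace ℝ (Fin n) → Prop} (hp : ∀ᶠ z in 𝓝 c, p z) :
    ∀ᶠ h in 𝓝[>] (0 : ℝ), ∀ z ∈ euclideanCube c h, p z := by
  obtain ⟨r, hr, hball⟩ := Metric.eventually_nhds_iff_ball.1 hp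
  have : Tendsto (fun h : ℝ => √n * h) (𝓝 0) (𝓝 (√n * 0)) :=
    (by fun_prop : Continuous fun h : ℝ => √n * h).tendsto 0
  rw [mul_zero] at this
  filter_upwards [(this.eventually_lt_const hr).filter_mono nhdsWithin_le_nhds,
    self_mem_nhdsWithin] with h hh h0 z hz
  exact hball z (closedBall_subset_ball hh
    (euclideanCube_subset_closedBall c (le_of_lt h0) hz))

lemma volume_real_euclideanCube (c : EuclideanSpace ℝ (Fin n)) {h : ℝ} (hh : 0 ≤ h) :
    volume.real (euclideanCube c h) = (2 * h) ^ n := by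
  have : euclideanCube c h = (WithLp.ofLp) ⁻¹' (Set.univ.pi fun i => Icc (c i - h) (c i + h)) := by
    ext z
    refine ⟨fun hz i _ => ?_, fun hz i => ?_⟩
    · have := abs_le.1 (hz i)
      constructor <;> linarith
    · have := hz i (mem_univ i)
      exact abs_le.2 ⟨by linarith [this.1], by linarith [this.2]⟩
  rw [this, measureReal_def, (PiLp.volume_preserving_ofLp (Fin n)).measure_preimage
    (MeasurableSet.univ_pi fun i => measurableSet_Icc).nullMeasurableSet, volume_pi_pi]
  simp only [Real.volume_Icc, Finset.prod_const, Finset.card_univ, Fintype.card_fin,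
    ENNReal.toReal_pow, add_sub_sub_cancel]
  rw [ENNReal.toReal_ofReal (by positivity)]
  ring

/-- Finitely many disjoint cubes in a connected open set can be carried homothetically onto any
equally numerous family of disjoint cubes of equal size. -/
lemma exists_homothetic_rearrangement [NeZero n] {Ω : Set (EuclideanSpace ℝ (Fin n))}
    (hΩ : IsOpen Ω) (hc : IsPreconnected Ω) {ι κ : Type*} (J : Finset ι) (L : Finset κ)
    {x : ι → EuclideanSpace ℝ (Fin n)} {r : ι → ℝ} (hr : ∀ j ∈ J, 0 < r j)
    (hx : ∀ j ∈ J, euclideanCube (x j) (r j) ⊆ Ω)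
    (hxd : (J : Set ι).PairwiseDisjoint fun j => euclideanCube (x j) (r j))
    {y : κ → EuclideanSpace ℝ (Fin n)} {ρ : ℝ} (hρ : 0 < ρ)
    (hy : ∀ l ∈ L, euclideanCube (y l) ρ ⊆ Ω)
    (hyd : (L : Set κ).PairwiseDisjoint fun l => euclideanCube (y l) ρ)
    (hJL : J.card ≤ L.card) :
    ∃ Ψ, IsCompactDiffeo Ω Ψ ∧
      ∀ j ∈ J, ∃ w, ∀ z ∈ euclideanCube (x j) (r j), Ψ z = w + (ρ / r j) • (z - x j) := by
  classical
  have hxi : InjOn x J := fun i hi j hj hij => by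
    by_contra hne
    exact Set.disjoint_left.1 (hxd hi hj hne) (mem_euclideanCube_self _ (hr i hi).le)
      (hij ▸ mem_euclideanCube_self _ (hr j hj).le)
  have hyi : InjOn y L := fun i hi j hj hij => by
    by_contra hne
    exact Set.disjoint_left.1 (hyd hi hj hne) (mem_euclideanCube_self _ hρ.le)
      (hij ▸ mem_euclideanCube_self _ hρ.le)
  obtain ⟨T, hTL, Φ, hΦ, himg, hloc⟩ := CanMove.exists_of_card_le hΩ hc
    (S := J.image x) (T := L.image y)
    (by
      rw [Finset.coe_image, image_subset_iff]
      exact fun j hj => hx j hj (mem_euclideanCube_self _ (hr j hj).le))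
    (by
      rw [Finset.coe_image, image_subset_iff]
      exact fun j hj => hy j hj (mem_euclideanCube_self _ hρ.le))
    (by rwa [Finset.card_image_of_injOn hxi, Finset.card_image_of_injOn hyi])
  have hη : ∀ᶠ η in 𝓝[>] (0 : ℝ), ∀ j ∈ J, η ≤ r j ∧
      ∀ z ∈ euclideanCube (x j) η, Φ z = z + (Φ (x j) - x j) := by
    rw [Filter.eventually_all_finset]
    intro j hj
    filter_upwards [Ioo_mem_nhdsGT (hr j hj), eventually_forall_mem_euclideanCube
      (hloc (x j) (Finset.mem_image_of_mem x hj))] with η h1 h2 using ⟨h1.2.le, h2⟩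
  obtain ⟨η, ⟨hη, hη0, hηρ⟩⟩ := (hη.and (Ioo_mem_nhdsGT hρ)).exists
  obtain ⟨A, hA, hAx⟩ := exists_homotheties J (Q := fun j => euclideanCube (x j) (r j)) (c := x)
    (t := fun j => η / r j) (fun j hj => isCompact_euclideanCube _ (hr j hj).le)
    (fun j hj => starConvex_euclideanCube _ (hr j hj).le) (fun j hj => div_pos hη0 (hr j hj))
    (fun j hj => (div_le_one (hr j hj)).2 (hη j hj).1) hxd hΩ hx
  obtain ⟨B, hB, hBy⟩ := exists_homotheties L (Q := fun l => euclideanCube (y l) ρ) (c := y)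
    (t := fun _ => η / ρ) (fun l _ => isCompact_euclideanCube _ hρ.le)
    (fun l _ => starConvex_euclideanCube _ hρ.le) (fun l _ => div_pos hη0 hρ)
    (fun l _ => (div_le_one hρ).2 hηρ.le) hyd hΩ hy
  refine ⟨_, (hA.trans hΦ).trans hB.symm, fun j hj => ?_⟩
  have hrj := hr j hj
  obtain ⟨l, hl, hlj⟩ : ∃ l ∈ L, y l = Φ (x j) := by
    have : Φ (x j) ∈ (T : Set _) := by
      rw [← himg]
      exact mem_image_of_mem _ (Finset.mem_image_of_mem x hj)
    simpa using hTL this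
  refine ⟨y l, fun z hz => ?_⟩
  rw [Equiv.trans_apply, Equiv.trans_apply, hAx j hj z hz, (hη j hj).2 _
    (add_smul_mem_euclideanCube hz (by positivity) (by field_simp; exact le_rfl)),
    Equiv.symm_apply_eq, hBy l hl _
    (add_smul_mem_euclideanCube hz (by positivity) (by field_simp; exact le_rfl)), hlj,
    add_sub_cancel_left, smul_smul, show η / ρ * (ρ / r j) = η / r j by field_simp]
  abel

/-- The points of the lattice `s ℤⁿ`. -/
noncomputable def gridPoint (s : ℝ) (k : Fin n → ℤ) : EuclideanSpace ℝ (Fin n) :=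
  WithLp.toLp 2 fun i => s * k i

lemma disjoint_euclideanCube_gridPoint {s h : ℝ} (hh : h < s / 2) {k l : Fin n → ℤ}
    (hkl : k ≠ l) :
    Disjoint (euclideanCube (gridPoint s k) h) (euclideanCube (gridPoint s l) h) := by
  rw [Set.disjoint_left]
  intro z hk hl
  obtain ⟨i, hi⟩ := Function.ne_iff.1 hkl
  have h1 := hk i
  have h2 := hl i
  simp only [gridPoint] at h1 h2
  have h3 : |s * (k i) - s * (l i)| ≤ 2 * h := by
    calc _ = |(z i - s * l i) - (z i - s * k i)| := by ring_nf
      _ ≤ |z i - s * l i| + |z i - s * k i| := abs_sub _ _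
      _ ≤ _ := by linarith
  have h0 : 0 ≤ h := (abs_nonneg _).trans h1
  have h4 : (1 : ℝ) ≤ |(k i : ℝ) - l i| := by
    exact_mod_cast Int.one_le_abs (sub_ne_zero.2 hi)
  rw [← mul_sub, abs_mul, abs_of_pos (by linarith : (0 : ℝ) < s)] at h3
  nlinarith

lemma exists_grid_cover {K : Set (EuclideanSpace ℝ (Fin n))} (hK : Bornology.IsBounded K) {s : ℝ}
    (hs : 0 < s) : ∃ N : Finset (Fin n → ℤ),
      K ⊆ ⋃ k ∈ N, euclideanCube (gridPoint s k) (s / 2) ∧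
      ∀ k ∈ N, euclideanCube (gridPoint s k) (s / 2) ⊆ cthickening (√n * s) K := by
  have hround : ∀ z : EuclideanSpace ℝ (Fin n),
      z ∈ euclideanCube (gridPoint s fun i => round (z i / s)) (s / 2) := fun z i => by
    have h := abs_sub_round (z i / s)
    have : z i - s * round (z i / s) = s * (z i / s - round (z i / s)) := by field_simp
    simp only [gridPoint]
    rw [this, abs_mul, abs_of_pos hs]
    nlinarith
  have hfin : ((fun z : EuclideanSpace ℝ (Fin n) => fun i => round (z i / s)) '' K).Finite := by
    obtain ⟨R, hR⟩ := hK.exists_norm_le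
    refine (Set.finite_Icc (fun _ => -⌈R / s + 1⌉) (fun _ => ⌈R / s + 1⌉)).subset ?_
    rintro _ ⟨z, hz, rfl⟩
    have key : ∀ i, |round (z i / s)| ≤ ⌈R / s + 1⌉ := fun i => by
      have h1 : |z i / s| ≤ R / s := by
        rw [abs_div, abs_of_pos hs]
        gcongr
        exact (PiLp.norm_apply_le z i).trans (hR z hz)
      have h2 := abs_sub_round (z i / s)
      have h3 : |(round (z i / s) : ℝ)| ≤ R / s + 1 := by
        rw [abs_le] at *
        constructor <;> linarith [h1.1, h1.2, h2.1, h2.2]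
      exact_mod_cast h3.trans (Int.le_ceil _)
    exact ⟨fun i => (abs_le.1 (key i)).1, fun i => (abs_le.1 (key i)).2⟩
  refine ⟨hfin.toFinset, fun z hz => mem_iUnion₂.2 ⟨_, by simpa using ⟨z, hz, rfl⟩, hround z⟩,
    fun k hk w hw => ?_⟩
  obtain ⟨z, hz, rfl⟩ := hfin.mem_toFinset.1 hk
  refine mem_cthickening_of_dist_le w z _ _ hz ?_
  have h1 := mem_closedBall.1 (euclideanCube_subset_closedBall _ (by positivity) hw)
  have h2 := mem_closedBall'.1 (euclideanCube_subset_closedBall _ (by positivity) (hround z))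
  refine (dist_triangle _ _ _).trans ((add_le_add h1 h2).trans_eq (by ring))

lemma volume_real_le_of_grid_cover {K : Set (EuclideanSpace ℝ (Fin n))} {s : ℝ} (hs : 0 < s)
    {N : Finset (Fin n → ℤ)} (hN : K ⊆ ⋃ k ∈ N, euclideanCube (gridPoint s k) (s / 2)) :
    volume.real K ≤ N.card * s ^ n := by
  have hfin : ∀ k, volume (euclideanCube (gridPoint s k : EuclideanSpace ℝ (Fin n)) (s / 2)) ≠ ⊤ :=
    fun k => (isCompact_euclideanCube _ (by positivity)).measure_lt_top.ne
  calc volume.real K ≤ volume.real (⋃ k ∈ N, euclideanCube (gridPoint s k) (s / 2)) :=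
        measureReal_mono hN (N.isCompact_biUnion fun k _ =>
          isCompact_euclideanCube _ (by positivity)).measure_lt_top.ne
    _ ≤ ∑ k ∈ N, volume.real (euclideanCube (gridPoint s k : EuclideanSpace ℝ (Fin n)) (s / 2)) :=
        measureReal_biUnion_finset_le _ _
    _ = N.card * s ^ n := by
        simp [volume_real_euclideanCube _ (half_pos hs).le, mul_div_cancel₀]

lemma card_mul_le_volume_real {W : Set (EuclideanSpace ℝ (Fin n))} (hW : volume W ≠ ⊤) {s θ : ℝ}
    (hs : 0 < s) (hθ : 0 ≤ θ) (hθ1 : θ < 1) {N : Finset (Fin n → ℤ)}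
    (hN : ∀ k ∈ N, euclideanCube (gridPoint s k) (s / 2) ⊆ W) :
    N.card * (θ * s) ^ n ≤ volume.real W := by
  have hlt : θ * s / 2 < s / 2 := by nlinarith
  calc N.card * (θ * s) ^ n = ∑ k ∈ N, volume.real (euclideanCube
          (gridPoint s k : EuclideanSpace ℝ (Fin n)) (θ * s / 2)) := by
        simp [volume_real_euclideanCube _ (by positivity : 0 ≤ θ * s / 2), mul_div_cancel₀]
    _ = volume.real (⋃ k ∈ N, euclideanCube (gridPoint s k) (θ * s / 2)) := by
        refine (measureReal_biUnion_finset (fun k _ l _ hkl =>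
          disjoint_euclideanCube_gridPoint hlt hkl)
          (fun k _ => (isClosed_euclideanCube _ _).measurableSet) ?_).symm
        exact fun k _ => (isCompact_euclideanCube _ (by positivity)).measure_lt_top.ne
    _ ≤ volume.real W := measureReal_mono
        (iUnion₂_subset fun k hk => (euclideanCube_mono _ hlt.le).trans (hN k hk)) hW

lemma volume_real_diff_le_of_grid_cover {K : Set (EuclideanSpace ℝ (Fin n))} {s θ : ℝ}
    (hs : 0 < s) (hθ : 0 ≤ θ) (hθ1 : θ ≤ 1)
    {N : Finset (Fin n → ℤ)} (hN : K ⊆ ⋃ k ∈ N, euclideanCube (gridPoint s k) (s / 2)) :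
    volume.real (K \ ⋃ k ∈ N, euclideanCube (gridPoint s k) (θ * s / 2)) ≤
      N.card * (s ^ n * (1 - θ ^ n)) := by
  have hle : θ * s / 2 ≤ s / 2 := by nlinarith
  have hfin : ∀ k, volume (euclideanCube (gridPoint s k : EuclideanSpace ℝ (Fin n)) (s / 2) \
      euclideanCube (gridPoint s k) (θ * s / 2)) < ⊤ := fun k =>
    (measure_mono sdiff_subset).trans_lt (isCompact_euclideanCube _ (by positivity)).measure_lt_top
  calc _ ≤ volume.real (⋃ k ∈ N, (euclideanCube (gridPoint s k) (s / 2) \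
          euclideanCube (gridPoint s k) (θ * s / 2))) := by
        refine measureReal_mono (fun z hz => ?_) (measure_biUnion_lt_top N.finite_toSet
          fun k _ => hfin k).ne
        obtain ⟨k, hk, hzk⟩ := mem_iUnion₂.1 (hN hz.1)
        exact mem_iUnion₂.2 ⟨k, hk, hzk, fun h => hz.2 (mem_iUnion₂.2 ⟨k, hk, h⟩)⟩
    _ ≤ ∑ k ∈ N, volume.real (euclideanCube (gridPoint s k : EuclideanSpace ℝ (Fin n)) (s / 2) \
          euclideanCube (gridPoint s k) (θ * s / 2)) := measureReal_biUnion_finset_le _ _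
    _ = N.card * (s ^ n * (1 - θ ^ n)) := by
        rw [Finset.sum_congr rfl fun k _ => ?_, Finset.sum_const, nsmul_eq_mul]
        rw [measureReal_sdiff (euclideanCube_mono _ hle) (isClosed_euclideanCube _ _).measurableSet
          (isCompact_euclideanCube _ (by positivity)).measure_lt_top.ne,
          volume_real_euclideanCube _ (by positivity), volume_real_euclideanCube _ (by positivity)]
        rw [show 2 * (s / 2) = s by ring, show 2 * (θ * s / 2) = θ * s by ring, mul_pow]
        ring

end Cube

/-- Finitely many disjoint compact sets, on each of which `f` is controlled by consecutive powers
of `q`, fill `Ω` up to small measure. -/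
lemma exists_compact_level_sets {α : Type*} [TopologicalSpace α] [T2Space α] [MeasurableSpace α]
    [BorelSpace α] {μ : Measure α} [μ.InnerRegularCompactLTTop] {Ω : Set α} (hΩ : MeasurableSet Ω)
    (hμ : μ Ω ≠ ⊤) {f : α → ℝ} (hf : AEMeasurable f (μ.restrict Ω))
    (hpos : ∀ᵐ x ∂μ.restrict Ω, 0 < f x) {q : ℝ} (hq : 1 < q) {ε : ENNReal} (hε : ε ≠ 0) :
    ∃ (I : Finset ℤ) (K : ℤ → Set α), (∀ i, IsCompact (K i)) ∧ (∀ i, K i ⊆ Ω) ∧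
      Pairwise (Function.onFun Disjoint K) ∧
      (∀ i, ∀ x ∈ K i, q ^ i ≤ f x ∧ f x < q ^ (i + 1)) ∧ μ (Ω \ ⋃ i ∈ I, K i) < ε := by
  set g := hf.mk f
  have hae : ∀ᵐ x ∂μ.restrict Ω, f x = g x ∧ 0 < f x := hf.ae_eq_mk.and hpos
  set N := toMeasurable (μ.restrict Ω) {x | ¬ (f x = g x ∧ 0 < f x)}
  have hNm : MeasurableSet N := measurableSet_toMeasurable _ _
  have hN : μ (N ∩ Ω) = 0 := by
    rw [← Measure.restrict_apply hNm, measure_toMeasurable]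
    exact hae
  have hgood : ∀ x ∉ N, f x = g x ∧ 0 < f x := fun x hx => by
    by_contra h
    exact hx (subset_toMeasurable _ _ h)
  let A : ℤ → Set α := fun i => (Ω \ N) ∩ g ⁻¹' Ico (q ^ i) (q ^ (i + 1))
  have hA : ∀ i, MeasurableSet (A i) := fun i =>
    MeasurableSet.inter (MeasurableSet.diff hΩ hNm) (hf.measurable_mk measurableSet_Ico)
  have hAΩ : ∀ i, A i ⊆ Ω := fun i x hx => hx.1.1
  obtain ⟨δ, hδ, hsum⟩ := ENNReal.exists_pos_sum_of_countable' hε ℤ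
  choose K hKA hK hKμ using fun i => (hA i).exists_isCompact_sdiff_lt
    (measure_ne_top_of_subset (hAΩ i) hμ) (hδ i).ne'
  have hlev : ∀ i, ∀ x ∈ K i, q ^ i ≤ f x ∧ f x < q ^ (i + 1) := fun i x hx => by
    obtain ⟨h1, h2⟩ := hKA i hx
    rw [(hgood x h1.2).1]
    exact h2
  have hall : μ (Ω \ ⋃ i, K i) < ε := by
    have hsub : Ω \ ⋃ i, K i ⊆ (N ∩ Ω) ∪ ⋃ i, (A i \ K i) := by
      rintro x ⟨hx, hxK⟩
      by_cases hxN : x ∈ N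
      · exact Or.inl ⟨hxN, hx⟩
      · obtain ⟨hfg, hf0⟩ := hgood x hxN
        rw [hfg] at hf0
        obtain ⟨i, hi⟩ := exists_mem_Ico_zpow hf0 hq
        exact Or.inr (mem_iUnion.2 ⟨i, ⟨⟨hx, hxN⟩, hi⟩, fun h => hxK (mem_iUnion.2 ⟨i, h⟩)⟩)
    calc μ (Ω \ ⋃ i, K i) ≤ μ (N ∩ Ω) + μ (⋃ i, (A i \ K i)) :=
          (measure_mono hsub).trans (measure_union_le _ _)
      _ ≤ ∑' i, δ i := by
          rw [hN, zero_add]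
          exact (measure_iUnion_le _).trans (ENNReal.tsum_le_tsum fun i => (hKμ i).le)
      _ < ε := hsum
  have hlim : Tendsto (μ ∘ fun I : Finset ℤ => Ω \ ⋃ i ∈ I, K i) atTop
      (𝓝 (μ (⋂ I : Finset ℤ, Ω \ ⋃ i ∈ I, K i))) := by
    refine tendsto_measure_iInter_atTop (fun I => ?_) (fun I J hIJ => ?_)
      ⟨∅, measure_ne_top_of_subset sdiff_subset hμ⟩
    · exact (MeasurableSet.diff hΩ
        (I.measurableSet_biUnion fun i _ => (hK i).measurableSet)).nullMeasurableSet
    · exact sdiff_subset_sdiff_right (biUnion_subset_biUnion_left hIJ)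
  have hinter : (⋂ I : Finset ℤ, Ω \ ⋃ i ∈ I, K i) ⊆ Ω \ ⋃ i, K i := by
    intro x hx
    rw [mem_iInter] at hx
    refine ⟨(hx ∅).1, fun h => ?_⟩
    obtain ⟨i, hi⟩ := mem_iUnion.1 h
    exact (hx {i}).2 (by simpa using hi)
  obtain ⟨I, hI⟩ := (hlim.eventually_lt_const ((measure_mono hinter).trans_lt hall)).exists
  refine ⟨I, K, hK, fun i => (hKA i).trans (hAΩ i), fun i j hij => ?_, hlev, hI⟩
  refine Set.disjoint_left.2 fun x hi hj => ?_
  obtain ⟨h1, h2⟩ := hlev i x hi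
  obtain ⟨h3, h4⟩ := hlev j x hj
  have h5 := (zpow_lt_zpow_iff_right₀ hq).1 (h1.trans_lt h4)
  have h6 := (zpow_lt_zpow_iff_right₀ hq).1 (h3.trans_lt h2)
  omega

/-- Disjoint compact subsets of an open set admit disjoint closed thickenings inside that set,
with almost the same measure. -/
lemma eventually_cthickening {α : Type*} [MetricSpace α] [ProperSpace α] [MeasurableSpace α]
    [OpensMeasurableSpace α] {μ : Measure α} [IsFiniteMeasureOnCompacts μ] {Ω : Set α}
    (hΩ : IsOpen Ω) {ι : Type*} (I : Finset ι) {K : ι → Set α} (hK : ∀ i ∈ I, IsCompact (K i))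
    (hKΩ : ∀ i ∈ I, K i ⊆ Ω) (hd : (I : Set ι).PairwiseDisjoint K) {η : ℝ} (hη : 0 < η) :
    ∀ᶠ δ in 𝓝[>] (0 : ℝ), (∀ i ∈ I, cthickening δ (K i) ⊆ Ω ∧
      μ.real (cthickening δ (K i)) ≤ μ.real (K i) + η) ∧
      (I : Set ι).PairwiseDisjoint fun i => cthickening δ (K i) := by
  refine Filter.Eventually.and ?_ ?_
  · rw [Filter.eventually_all_finset]
    intro i hi
    refine Filter.Eventually.and ?_ ?_
    · obtain ⟨δ, hδ, h⟩ := (hK i hi).exists_cthickening_subset_open hΩ (hKΩ i hi)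
      filter_upwards [Ioo_mem_nhdsGT hδ] with s hs using (cthickening_mono hs.2.le _).trans h
    · have := (ENNReal.tendsto_toReal (hK i hi).measure_lt_top.ne).comp
        (tendsto_measure_cthickening_of_isCompact (μ := μ) (hK i hi))
      refine Filter.Eventually.filter_mono nhdsWithin_le_nhds ?_
      filter_upwards [this.eventually_lt_const (lt_add_of_pos_right _ hη)] with s hs using hs.le
  · have : ∀ i ∈ I, ∀ j ∈ I, ∀ᶠ δ in 𝓝[>] (0 : ℝ), i ≠ j →
        Disjoint (cthickening δ (K i)) (cthickening δ (K j)) := by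
      intro i hi j hj
      by_cases hij : i = j
      · simp [hij]
      · obtain ⟨δ, hδ, h⟩ := (hd hi hj hij).exists_cthickenings (hK i hi) (hK j hj).isClosed
        filter_upwards [Ioo_mem_nhdsGT hδ] with s hs _
        exact h.mono (cthickening_mono hs.2.le _) (cthickening_mono hs.2.le _)
    have h2 : ∀ᶠ δ in 𝓝[>] (0 : ℝ), ∀ i ∈ I, ∀ j ∈ I, i ≠ j →
        Disjoint (cthickening δ (K i)) (cthickening δ (K j)) := by
      simp only [Filter.eventually_all_finset]
      exact this
    filter_upwards [h2] with δ hδ i hi j hj hij using hδ i hi j hj hij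

lemma HasFDerivAt.det_of_eventually_homothety {E : Type*} [NormedAddCommGroup E] [NormedSpace ℝ E]
    {Ψ : E → E} {w x z : E} {t : ℝ} (h : ∀ᶠ y in 𝓝 z, Ψ y = w + t • (y - x)) :
    (fderiv ℝ Ψ z).det = t ^ Module.finrank ℝ E := by
  have : HasFDerivAt Ψ (t • ContinuousLinearMap.id ℝ E) z := by
    refine HasFDerivAt.congr_of_eventuallyEq ?_ h
    exact (((hasFDerivAt_id z).sub_const x).const_smul t).const_add w
  rw [this.fderiv, ContinuousLinearMap.det, ContinuousLinearMap.toLinearMap_smul,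
    LinearMap.det_smul]
  simp

/-- Piecewise constant densities are Jacobians of diffeomorphisms, up to a set of small measure. -/
lemma exists_diffeo_det_eq {n : ℕ} [NeZero n] {Ω : Set (EuclideanSpace ℝ (Fin n))}
    (hΩ : IsOpen Ω) (hc : IsPreconnected Ω) {ι : Type*} (I : Finset ι)
    {K : ι → Set (EuclideanSpace ℝ (Fin n))} (hK : ∀ i ∈ I, IsCompact (K i))
    (hKΩ : ∀ i ∈ I, K i ⊆ Ω) (hd : (I : Set ι).PairwiseDisjoint K)
    {c : ι → ℝ} (hcpos : ∀ i ∈ I, 0 < c i)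
    (hvol : ENNReal.ofReal (∑ i ∈ I, c i * volume.real (K i)) < volume Ω)
    {ε : ℝ} (hε : 0 < ε) :
    ∃ Ψ, IsCompactDiffeo Ω Ψ ∧ ∃ K' : ι → Set (EuclideanSpace ℝ (Fin n)),
      (∀ i ∈ I, IsCompact (K' i)) ∧ (∀ i ∈ I, K' i ⊆ K i) ∧
      (∑ i ∈ I, volume.real (K i \ K' i) < ε) ∧
      ∀ i ∈ I, ∀ x ∈ K' i, (fderiv ℝ Ψ x).det = c i := by
  classical
  obtain ⟨L, hLΩ, hL, hLvol⟩ := hΩ.exists_lt_isCompact hvol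
  rw [ENNReal.ofReal_lt_iff_lt_toReal
    (Finset.sum_nonneg fun i hi => mul_nonneg (hcpos i hi).le measureReal_nonneg)
    hL.measure_lt_top.ne, ← measureReal_def] at hLvol
  obtain ⟨η, ⟨hη1, hη2⟩, hη0, hη1'⟩ : ∃ η : ℝ,
      ((∑ i ∈ I, c i * (volume.real (K i) + η) < (1 - η) ^ n * volume.real L) ∧
      (∑ i ∈ I, (volume.real (K i) + η)) * (1 - (1 - η) ^ n) < (1 - η) ^ n * ε) ∧
        η ∈ Ioo (0 : ℝ) 1 := by
    have h1 : ∀ᶠ η in 𝓝 (0 : ℝ), ∑ i ∈ I, c i * (volume.real (K i) + η) <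
        (1 - η) ^ n * volume.real L :=
      ContinuousAt.eventually_lt (by fun_prop) (by fun_prop) (by simpa using hLvol)
    have h2 : ∀ᶠ η in 𝓝 (0 : ℝ), (∑ i ∈ I, (volume.real (K i) + η)) * (1 - (1 - η) ^ n) <
        (1 - η) ^ n * ε :=
      ContinuousAt.eventually_lt (by fun_prop) (by fun_prop) (by simpa using hε)
    exact (((h1.and h2).filter_mono nhdsWithin_le_nhds).and (Ioo_mem_nhdsGT one_pos)).exists
  set θ := 1 - η with hθ
  have hθ0 : 0 < θ := by linarith
  have hθ1 : θ < 1 := by linarith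
  have hθn : 0 < θ ^ n := by positivity
  obtain ⟨δ, ⟨⟨hδK, hδd⟩, hδL⟩, hδ0⟩ := (((eventually_cthickening (μ := volume) hΩ I hK hKΩ hd
    hη0).and (eventually_cthickening (μ := volume) hΩ {()} (K := fun _ => L) (by simpa using hL)
      (by simpa using hLΩ) (by simp) hη0)).and self_mem_nhdsWithin).exists
  have hδ0 : 0 < δ := hδ0
  replace hδL : cthickening δ L ⊆ Ω := (hδL.1 () (by simp)).1
  let a : ι → ℝ := fun i => (c i)⁻¹ ^ ((n : ℝ)⁻¹)
  have ha : ∀ i ∈ I, 0 < a i := fun i hi => Real.rpow_pos_of_pos (inv_pos.2 (hcpos i hi)) _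
  have han : ∀ i ∈ I, a i ^ n = (c i)⁻¹ := fun i hi =>
    Real.rpow_inv_natCast_pow (inv_pos.2 (hcpos i hi)).le (NeZero.ne n)
  obtain ⟨s, ⟨hsL, hsK⟩, hs0⟩ : ∃ s : ℝ, (√n * s ≤ δ ∧ ∀ i ∈ I, √n * (s * a i) ≤ δ) ∧ 0 < s := by
    have h1 : ∀ b : ℝ, ∀ᶠ s in 𝓝[>] (0 : ℝ), √n * (s * b) ≤ δ := fun b => by
      have : Tendsto (fun s : ℝ => √n * (s * b)) (𝓝 0) (𝓝 (√n * (0 * b))) :=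
        (by fun_prop : Continuous fun s : ℝ => √n * (s * b)).tendsto 0
      rw [zero_mul, mul_zero] at this
      filter_upwards [(this.eventually_lt_const hδ0).filter_mono nhdsWithin_le_nhds] with s hs
        using hs.le
    have h2 : ∀ᶠ s in 𝓝[>] (0 : ℝ), ∀ i ∈ I, √n * (s * a i) ≤ δ := by
      rw [Filter.eventually_all_finset]
      exact fun i _ => h1 (a i)
    obtain ⟨s, ⟨h3, h4⟩, h5⟩ := (((h1 1).and h2).and self_mem_nhdsWithin).exists
    exact ⟨s, ⟨by simpa using h3, h4⟩, h5⟩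
  have hsa : ∀ i ∈ I, 0 < s * a i := fun i hi => mul_pos hs0 (ha i hi)
  obtain ⟨M, hML, hMsub⟩ := exists_grid_cover hL.isBounded hs0
  have hN : ∀ i, ∃ N : Finset (Fin n → ℤ), i ∈ I →
      K i ⊆ ⋃ k ∈ N, euclideanCube (gridPoint (s * a i) k) (s * a i / 2) ∧
      ∀ k ∈ N, euclideanCube (gridPoint (s * a i) k) (s * a i / 2) ⊆
        cthickening (√n * (s * a i)) (K i) := fun i => by
    by_cases hi : i ∈ I
    · obtain ⟨N, hN⟩ := exists_grid_cover (hK i hi).isBounded (hsa i hi)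
      exact ⟨N, fun _ => hN⟩
    · exact ⟨∅, fun h => absurd h hi⟩
  choose N hN using hN
  have hNsub : ∀ i ∈ I, ∀ k ∈ N i, euclideanCube (gridPoint (s * a i) k) (s * a i / 2) ⊆
      cthickening δ (K i) := fun i hi k hk =>
    ((hN i hi).2 k hk).trans (cthickening_mono (hsK i hi) _)
  have hNcard : ∀ i ∈ I, (N i).card * (s * a i) ^ n ≤ (volume.real (K i) + η) / θ ^ n := by
    intro i hi
    rw [le_div_iff₀ hθn]
    calc _ = (N i).card * (θ * (s * a i)) ^ n := by
          rw [mul_pow θ, mul_right_comm, mul_assoc]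
      _ ≤ volume.real (cthickening δ (K i)) := card_mul_le_volume_real
          (hK i hi).cthickening.measure_lt_top.ne (hsa i hi) hθ0.le hθ1 (hNsub i hi)
      _ ≤ _ := (hδK i hi).2
  have hcard : (I.sigma N).card ≤ M.card := by
    rw [Finset.card_sigma, ← Nat.cast_le (α := ℝ), Nat.cast_sum]
    refine le_of_mul_le_mul_right ?_ (pow_pos hs0 n)
    calc (∑ i ∈ I, ((N i).card : ℝ)) * s ^ n
        = ∑ i ∈ I, c i * ((N i).card * (s * a i) ^ n) := by
          rw [Finset.sum_mul]
          refine Finset.sum_congr rfl fun i hi => ?_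
          rw [mul_pow, han i hi]
          field_simp [(hcpos i hi).ne']
      _ ≤ ∑ i ∈ I, c i * ((volume.real (K i) + η) / θ ^ n) :=
          Finset.sum_le_sum fun i hi => mul_le_mul_of_nonneg_left (hNcard i hi) (hcpos i hi).le
      _ = (∑ i ∈ I, c i * (volume.real (K i) + η)) / θ ^ n := by
          rw [Finset.sum_div]
          exact Finset.sum_congr rfl fun i _ => (mul_div_assoc _ _ _).symm
      _ ≤ volume.real L := by
          rw [div_le_iff₀' hθn]
          exact hη1.le
      _ ≤ M.card * s ^ n := volume_real_le_of_grid_cover hs0 hML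
  set θ' := (1 + θ) / 2 with hθ'
  have hθ'0 : 0 < θ' := by positivity
  have hlt : ∀ {b : ℝ}, 0 < b → θ' * b / 2 < b / 2 := fun hb => by
    have : θ' < 1 := by linarith
    nlinarith
  obtain ⟨Ψ, hΨ, h⟩ := exists_homothetic_rearrangement hΩ hc (I.sigma N) M
    (x := fun j => gridPoint (s * a j.1) j.2) (r := fun j => θ' * (s * a j.1) / 2)
    (y := gridPoint s) (ρ := θ' * s / 2)
    (fun j hj => by
      have := hsa j.1 (Finset.mem_sigma.1 hj).1
      positivity)
    (fun j hj => by
      obtain ⟨hi, hk⟩ := Finset.mem_sigma.1 hj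
      exact (euclideanCube_mono _ (hlt (hsa _ hi)).le).trans
        ((hNsub _ hi _ hk).trans (hδK _ hi).1))
    (by
      rintro ⟨i, k⟩ hik ⟨j, l⟩ hjl hne
      obtain ⟨hi, hk⟩ := Finset.mem_sigma.1 hik
      obtain ⟨hj, hl⟩ := Finset.mem_sigma.1 hjl
      by_cases hij : i = j
      · subst hij
        exact disjoint_euclideanCube_gridPoint (hlt (hsa _ hi)) fun hkl =>
          hne (congrArg (Sigma.mk i) hkl)
      · exact (hδd hi hj hij).mono
          ((euclideanCube_mono _ (hlt (hsa _ hi)).le).trans (hNsub _ hi _ hk))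
          ((euclideanCube_mono _ (hlt (hsa _ hj)).le).trans (hNsub _ hj _ hl)))
    (by positivity)
    (fun k hk => (euclideanCube_mono _ (hlt hs0).le).trans
      ((hMsub k hk).trans ((cthickening_mono hsL _).trans hδL)))
    (fun k _ l _ hkl => disjoint_euclideanCube_gridPoint (hlt hs0) hkl) hcard
  refine ⟨Ψ, hΨ, fun i => K i ∩ ⋃ k ∈ N i, euclideanCube (gridPoint (s * a i) k)
    (θ * (s * a i) / 2), fun i hi => ?_, fun i _ => inter_subset_left, ?_, ?_⟩
  · exact (hK i hi).inter_right ((N i).finite_toSet.isClosed_biUnion fun k _ =>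
      isClosed_euclideanCube _ _)
  · calc _ ≤ ∑ i ∈ I, (volume.real (K i) + η) / θ ^ n * (1 - θ ^ n) := by
          refine Finset.sum_le_sum fun i hi => ?_
          rw [sdiff_self_inter]
          refine (volume_real_diff_le_of_grid_cover (hsa i hi) hθ0.le hθ1.le (hN i hi).1).trans ?_
          rw [← mul_assoc]
          exact mul_le_mul_of_nonneg_right (hNcard i hi)
            (sub_nonneg.2 (pow_le_one₀ hθ0.le hθ1.le))
      _ = (∑ i ∈ I, (volume.real (K i) + η)) * (1 - θ ^ n) / θ ^ n := by
          rw [Finset.sum_mul, Finset.sum_div]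
          exact Finset.sum_congr rfl fun i _ => div_mul_eq_mul_div _ _ _
      _ < ε := by
          rw [div_lt_iff₀' hθn]
          exact hη2
  · rintro i hi z ⟨-, hz⟩
    obtain ⟨k, hk, hzk⟩ := mem_iUnion₂.1 hz
    obtain ⟨w, hw⟩ := h ⟨i, k⟩ (Finset.mem_sigma.2 ⟨hi, hk⟩)
    have hsai := hsa i hi
    have hai := ha i hi
    have hnhds := euclideanCube_mem_nhds hzk (h' := θ' * (s * a i) / 2) (by
      have : θ < θ' := by linarith
      gcongr)
    rw [HasFDerivAt.det_of_eventually_homothety (Filter.mem_of_superset hnhds hw),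
      finrank_euclideanSpace_fin,
      show θ' * s / 2 / (θ' * (s * a i) / 2) = (a i)⁻¹ by field_simp, inv_pow, han i hi, inv_inv]

/-- Approximate prescription of the Jacobian: for integrable a.e.-positive `f` on a bounded
domain `Ω` with `∫_Ω f = |Ω|` and any `ε > 0`, there is a compact `K ⊆ Ω` with
`|Ω \ K| < ε` and a `C^∞` diffeomorphism `Ψ` of `Ω` onto itself, identity near `∂Ω`, with
`|det DΨ − f| < ε f` on `K`. -/
theorem stmt11 {n : ℕ} (Ω : Set (EuclideanSpace ℝ (Fin n)))
    (hΩo : IsOpen Ω) (hΩc : IsConnected Ω) (hΩb : Bornology.IsBounded Ω)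
    (f : EuclideanSpace ℝ (Fin n) → ℝ)
    (hfi : IntegrableOn f Ω) (hfpos : ∀ᵐ x ∂volume.restrict Ω, 0 < f x)
    (hint : ∫ x in Ω, f x = (volume Ω).toReal) :
    ∀ ε > (0 : ℝ), ∃ K, IsCompact K ∧ K ⊆ Ω ∧ volume (Ω \ K) < ENNReal.ofReal ε ∧
      ∃ Ψ : EuclideanSpace ℝ (Fin n) → EuclideanSpace ℝ (Fin n),
        ContDiffOn ℝ (⊤ : ℕ∞) Ψ Ω ∧ Set.InjOn Ψ Ω ∧ Ψ '' Ω = Ω ∧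
        (∀ x ∈ Ω, IsUnit (fderiv ℝ Ψ x)) ∧
        (∃ K', IsCompact K' ∧ K' ⊆ Ω ∧ ∀ x ∈ Ω \ K', Ψ x = x) ∧
        ∀ x ∈ K, |(fderiv ℝ Ψ x).det - f x| < ε * f x := by
  intro ε hε
  rcases Nat.eq_zero_or_pos n with rfl | hn
  · have hΩ : Ω = univ := Subsingleton.eq_univ_of_nonempty hΩc.nonempty
    subst hΩ
    refine ⟨univ, isCompact_univ, subset_rfl, by simpa using hε, id, contDiffOn_id, injOn_id _,
      image_id _, fun x _ => by rw [fderiv_id]; exact isUnit_one,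
      ⟨univ, isCompact_univ, subset_rfl, fun x _ => rfl⟩, fun x _ => ?_⟩
    have hv : volume (univ : Set (EuclideanSpace ℝ (Fin 0))) = 1 := by
      rw [← preimage_univ (f := WithLp.ofLp), (PiLp.volume_preserving_ofLp
        (Fin 0)).measure_preimage MeasurableSet.univ.nullMeasurableSet]
      simp [volume_pi]
    have hfx : f x = 1 := by
      have : f = fun _ => f x := funext fun y => by rw [Subsingleton.elim y x]
      rw [this] at hint
      simpa [measureReal_def, hv] using hint
    rw [hfx, ContinuousLinearMap.det, LinearMap.det_eq_one_of_finrank_eq_zero (by simp)]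
    simpa using hε
  have : NeZero n := ⟨hn.ne'⟩
  have hΩfin : volume Ω ≠ ⊤ := hΩb.measure_lt_top.ne
  have hΩpos : 0 < volume.real Ω :=
    ENNReal.toReal_pos (hΩo.measure_pos volume hΩc.nonempty).ne' hΩfin
  set q := √(1 + ε / 2) with hq
  have hq1 : 1 < q := by
    rw [hq, Real.lt_sqrt zero_le_one]
    linarith
  have hq0 : 0 < q := one_pos.trans hq1
  have hqq : q ^ 2 = 1 + ε / 2 := Real.sq_sqrt (by positivity)
  obtain ⟨I, K, hK, hKΩ, hKd, hKf, hKvol⟩ := exists_compact_level_sets (μ := volume)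
    hΩo.measurableSet hΩfin hfi.aemeasurable hfpos hq1
    (ε := ENNReal.ofReal (ε / 2)) (by simpa using hε)
  have hKq : ∀ i, ∀ x ∈ K i, q * q ^ (i - 1) ≤ f x ∧ f x < q ^ 2 * q ^ (i - 1) := fun i x hx => by
    have h := hKf i x hx
    rwa [show i = 1 + (i - 1) by ring, zpow_add₀ hq0.ne', zpow_one,
      show 1 + (i - 1) + 1 = 2 + (i - 1) by ring, zpow_add₀ hq0.ne', zpow_ofNat] at h
  have hmass : q * ∑ i ∈ I, q ^ (i - 1) * volume.real (K i) ≤ volume.real Ω := by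
    calc _ = ∑ i ∈ I, ∫ _ in K i, q * q ^ (i - 1) := by
          rw [Finset.mul_sum]
          refine Finset.sum_congr rfl fun i _ => ?_
          rw [setIntegral_const, smul_eq_mul]
          ring
      _ ≤ ∑ i ∈ I, ∫ x in K i, f x := by
          refine Finset.sum_le_sum fun i _ => setIntegral_mono_on
            (integrableOn_const (hK i).measure_lt_top.ne) (hfi.mono_set (hKΩ i))
            (hK i).measurableSet fun x hx => (hKq i x hx).1
      _ = ∫ x in ⋃ i ∈ I, K i, f x :=
          (integral_biUnion_finset I (fun i _ => (hK i).measurableSet)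
            (fun i _ j _ hij => hKd hij) fun i _ => hfi.mono_set (hKΩ i)).symm
      _ ≤ ∫ x in Ω, f x := setIntegral_mono_set hfi (hfpos.mono fun _ h => h.le)
          (iUnion₂_subset fun i _ => hKΩ i).eventuallyLE
      _ = _ := hint
  have hsum : ENNReal.ofReal (∑ i ∈ I, q ^ (i - 1) * volume.real (K i)) < volume Ω := by
    have h0 : 0 ≤ ∑ i ∈ I, q ^ (i - 1) * volume.real (K i) :=
      Finset.sum_nonneg fun i _ => mul_nonneg (by positivity) measureReal_nonneg
    rw [ENNReal.ofReal_lt_iff_lt_toReal h0 hΩfin, ← measureReal_def]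
    rcases h0.eq_or_lt with h | h
    · rwa [← h]
    · exact (lt_mul_of_one_lt_left h hq1).trans_le hmass
  obtain ⟨Ψ, hΨ, K', hK', hK'K, hloss, hdet⟩ := exists_diffeo_det_eq hΩo hΩc.isPreconnected I
    (fun i _ => hK i) (fun i _ => hKΩ i) (fun i _ j _ hij => hKd hij)
    (c := fun i => q ^ (i - 1)) (fun i _ => by positivity) hsum (half_pos hε)
  refine ⟨⋃ i ∈ I, K' i, I.isCompact_biUnion hK',
    iUnion₂_subset fun i hi => (hK'K i hi).trans (hKΩ i), ?_, Ψ, hΨ.smooth.contDiffOn,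
    Ψ.injective.injOn, hΨ.image_eq, fun x _ => hΨ.isUnit_fderiv x, ?_, fun x hx => ?_⟩
  · have hsub : Ω \ ⋃ i ∈ I, K' i ⊆ (Ω \ ⋃ i ∈ I, K i) ∪ ⋃ i ∈ I, (K i \ K' i) := by
      rintro x ⟨hx, hxK'⟩
      by_cases hxK : x ∈ ⋃ i ∈ I, K i
      · obtain ⟨i, hi, hxi⟩ := mem_iUnion₂.1 hxK
        exact Or.inr (mem_iUnion₂.2 ⟨i, hi, hxi, fun h => hxK' (mem_iUnion₂.2 ⟨i, hi, h⟩)⟩)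
      · exact Or.inl ⟨hx, hxK⟩
    have hlossE : volume (⋃ i ∈ I, (K i \ K' i)) ≤ ENNReal.ofReal (ε / 2) := by
      refine (measure_biUnion_finset_le _ _).trans ?_
      have hfin : ∀ i ∈ I, volume (K i \ K' i) ≠ ⊤ := fun i _ =>
        measure_ne_top_of_subset sdiff_subset (hK i).measure_lt_top.ne
      rw [← ENNReal.ofReal_toReal (ENNReal.sum_ne_top.2 hfin), ENNReal.toReal_sum hfin]
      exact ENNReal.ofReal_le_ofReal hloss.le
    calc volume (Ω \ ⋃ i ∈ I, K' i)
        ≤ volume (Ω \ ⋃ i ∈ I, K i) + volume (⋃ i ∈ I, (K i \ K' i)) :=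
          (measure_mono hsub).trans (measure_union_le _ _)
      _ < ENNReal.ofReal (ε / 2) + ENNReal.ofReal (ε / 2) :=
          ENNReal.add_lt_add_of_lt_of_le (ne_top_of_le_ne_top ENNReal.ofReal_ne_top hlossE)
            hKvol hlossE
      _ = ENNReal.ofReal ε := by
          rw [← ENNReal.ofReal_add (by positivity) (by positivity), add_halves]
  · obtain ⟨L, hL, hLΩ, h⟩ := hΨ.support
    exact ⟨L, hL, hLΩ, fun x hx => h x hx.2⟩
  · obtain ⟨i, hi, hxi⟩ := mem_iUnion₂.1 hx
    have hc : 0 < q ^ (i - 1) := by positivity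
    obtain ⟨h1, h2⟩ := hKq i x (hK'K i hi hxi)
    rw [hdet i hi x hxi, abs_lt]
    have h3 : q ^ (i - 1) < f x := (lt_mul_of_one_lt_left hc hq1).trans_le h1
    rw [hqq] at h2
    constructor <;> nlinarith
end
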